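/- arXiv:1510.03917 — 6 statements merged into one kernel-verified Lean document; each statement's English description precedes it below -/
import Mathlib

section
/- For every integer q ≥ 1, the numbers a_ℓ satisfy the recursion: a_0 = 0, a_1 = q, a_{2k} = q·a_{2k−1} − a_k for every integer k ≥ 1, and a_{2k+1} = q·a_{2k} for every integer k ≥ 1. -/
/-- `V` is a bifix of `W`: `V` is nonempty and is both a proper prefix
and a proper suffix of `W`. -/
def IsBifix {α : Type*} (V W : List α) : Prop :=
  V ≠ [] ∧ (∃ A, A ≠ [] ∧ W = V ++ A) ∧ (∃ B, B ≠ [] ∧ W = B ++ V)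

/-- A word is bifix-free if it has no bifix. -/
def BifixFree {α : Type*} (W : List α) : Prop := ∀ V, ¬ IsBifix V W

/-- `aCount q ℓ` is the number of bifix-free words of length `ℓ` over a `q`-letter
alphabet, with the convention `aCount q 0 = 0`. -/
noncomputable def aCount (q ℓ : ℕ) : ℕ :=
  if ℓ = 0 then 0 else Nat.card {W : List (Fin q) // W.length = ℓ ∧ BifixFree W}

/-- The prefix and the suffix of length `m` of `W` differ, for every `1 ≤ m ≤ k`. -/
def NoBifixUpTo {α : Type*} (k : ℕ) (W : List α) : Prop :=
  ∀ m, 0 < m → m ≤ k → W.take m ≠ W.drop (W.length - m)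

theorem bifixFree_iff_take_ne_drop {α : Type*} (W : List α) :
    BifixFree W ↔ ∀ m, 0 < m → m < W.length → W.take m ≠ W.drop (W.length - m) := by
  constructor
  · intro h m hm hmn heq
    refine h (W.take m) ⟨?_, ⟨W.drop m, ?_, (List.take_append_drop m W).symm⟩,
      ⟨W.take (W.length - m), ?_, ?_⟩⟩
    · apply List.ne_nil_of_length_pos; simp; omega
    · apply List.ne_nil_of_length_pos; simp; omega
    · apply List.ne_nil_of_length_pos; simp; omega
    · rw [heq, List.take_append_drop]
  · rintro h V ⟨hV, ⟨A, hA, hWA⟩, ⟨B, hB, hWB⟩⟩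
    have hV' := List.length_pos_iff.mpr hV
    have hA' := List.length_pos_iff.mpr hA
    have hlen := congrArg List.length hWA
    have hlen' := congrArg List.length hWB
    rw [List.length_append] at hlen hlen'
    refine h V.length hV' (by omega) ?_
    have h1 : W.take V.length = V := by rw [hWA]; simp
    have h2 : W.length - V.length = B.length := by omega
    rw [h1, h2, hWB]
    simp

theorem take_eq_drop_iff_getElem? {α : Type*} {W : List α} {m : ℕ} (hm : m ≤ W.length) :
    W.take m = W.drop (W.length - m) ↔ ∀ i < m, W[i]? = W[W.length - m + i]? := by
  rw [List.ext_getElem?_iff]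
  constructor
  · intro h i hi
    have := h i
    rwa [List.getElem?_take_of_lt hi, List.getElem?_drop] at this
  · intro h i
    rcases lt_or_ge i m with hi | hi
    · rw [List.getElem?_take_of_lt hi, List.getElem?_drop, h i hi]
    · rw [List.getElem?_eq_none (by simp; omega), List.getElem?_eq_none (by simp; omega)]

/-- A word with a bifix has one of at most half its length. -/
theorem bifixFree_iff_noBifixUpTo_half {α : Type*} {W : List α} {k : ℕ}
    (hk : k < W.length) (hk' : W.length ≤ 2 * k + 1) :
    BifixFree W ↔ NoBifixUpTo k W := by
  rw [bifixFree_iff_take_ne_drop]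
  constructor
  · intro h m hm hmk
    exact h m hm (by omega)
  · intro h m
    induction m using Nat.strong_induction_on with
    | _ m ih =>
      intro hm hmn heq
      rcases le_or_gt m k with hmk | hmk
      · exact h m hm hmk heq
      · refine ih (2 * m - W.length) (by omega) (by omega) (by omega) ?_
        rw [take_eq_drop_iff_getElem? (by omega)] at heq ⊢
        intro i hi
        rw [heq i (by omega), heq (W.length - m + i) (by omega)]
        congr 1
        omega

theorem noBifixUpTo_insertIdx_iff {α : Type*} {W : List α} {k : ℕ} (hk : 2 * k ≤ W.length)
    (x : α) : NoBifixUpTo k (W.insertIdx k x) ↔ NoBifixUpTo k W := by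
  have hlen : (W.insertIdx k x).length = W.length + 1 := by
    rw [List.length_insertIdx, if_pos (by omega)]
  refine forall_congr' fun m => forall_congr' fun hm => forall_congr' fun hmk => not_congr ?_
  rw [take_eq_drop_iff_getElem? (by omega), take_eq_drop_iff_getElem? (by omega), hlen]
  refine forall_congr' fun i => forall_congr' fun hi => ?_
  rw [List.getElem?_insertIdx_of_lt (by omega), List.getElem?_insertIdx_of_gt (by omega)]
  rw [show W.length + 1 - m + i - 1 = W.length - m + i by omega]

/-- Inserting a letter in the middle of a word does not affect its short bifixes. -/
def insertMiddleEquiv {α : Type*} {n k : ℕ} (hk : 2 * k ≤ n) :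
    α × {W : List α // W.length = n ∧ NoBifixUpTo k W} ≃
      {W : List α // W.length = n + 1 ∧ NoBifixUpTo k W} where
  toFun p := ⟨p.2.1.insertIdx k p.1,
    by rw [List.length_insertIdx, if_pos (by have := p.2.2.1; omega), p.2.2.1],
    (noBifixUpTo_insertIdx_iff (by have := p.2.2.1; omega) _).mpr p.2.2.2⟩
  invFun W := ⟨W.1[k]'(by have := W.2.1; omega), W.1.eraseIdx k, by
    have hlen := W.2.1
    have hlen' : (W.1.eraseIdx k).length = n := by
      rw [List.length_eraseIdx, if_pos (by omega)]; omega
    refine ⟨hlen', (noBifixUpTo_insertIdx_iff (by omega) (W.1[k]'(by omega))).mp ?_⟩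
    rw [List.insertIdx_eraseIdx_getElem]
    exact W.2.2⟩
  left_inv := by
    rintro ⟨x, W, hW, h⟩
    simp [List.eraseIdx_insertIdx_self]
  right_inv := by
    rintro ⟨W, hW, h⟩
    simp [List.insertIdx_eraseIdx_getElem]

theorem noBifixUpTo_append_self_iff {α : Type*} {Y : List α} (hY : Y ≠ []) :
    NoBifixUpTo (Y.length - 1) (Y ++ Y) ↔ BifixFree Y := by
  have hpos := List.length_pos_iff.mpr hY
  rw [bifixFree_iff_take_ne_drop]
  refine forall_congr' fun m => forall_congr' fun hm => ?_
  rw [show m ≤ Y.length - 1 ↔ m < Y.length by omega]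
  refine forall_congr' fun hmY => not_congr ?_
  rw [List.take_append_of_le_length hmY.le, List.length_append, List.drop_append,
    List.drop_eq_nil_of_le (by omega), List.nil_append,
    show Y.length + Y.length - m - Y.length = Y.length - m by omega]

theorem noBifixUpTo_pred_iff {α : Type*} {W : List α} {k : ℕ} (hk : 1 ≤ k)
    (hW : W.length = 2 * k) :
    NoBifixUpTo k W ↔ NoBifixUpTo (k - 1) W ∧ W.take k ≠ W.drop k := by
  have hhalf : W.length - k = k := by omega
  constructor
  · intro h
    exact ⟨fun m hm hmk => h m hm (by omega), by simpa [hhalf] using h k hk le_rfl⟩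
  · rintro ⟨h, hne⟩ m hm hmk
    rcases hmk.eq_or_lt with rfl | hlt
    · rwa [hhalf]
    · exact h m hm (by omega)

/-- Squares with no bifix shorter than their half are the squares of bifix-free words. -/
def squareEquiv {α : Type*} {k : ℕ} (hk : 1 ≤ k) :
    {Y : List α // Y.length = k ∧ BifixFree Y} ≃
      {W : List α // (W.length = 2 * k ∧ NoBifixUpTo (k - 1) W) ∧ W.take k = W.drop k} where
  toFun Y := ⟨Y.1 ++ Y.1, by
    obtain ⟨Y, rfl, h⟩ := Y
    refine ⟨⟨by simp; omega, ?_⟩, by simp⟩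
    exact (noBifixUpTo_append_self_iff (List.ne_nil_of_length_pos hk)).mpr h⟩
  invFun W := ⟨W.1.take k, by
    obtain ⟨W, ⟨hW, h⟩, heq⟩ := W
    have hlen : (W.take k).length = k := by simp; omega
    have hsq : W.take k ++ W.take k = W := by
      nth_rewrite 2 [heq]
      exact List.take_append_drop k W
    have hne : W.take k ≠ [] := List.ne_nil_of_length_pos (by omega)
    refine ⟨hlen, (noBifixUpTo_append_self_iff hne).mp ?_⟩
    rwa [hsq, hlen]⟩
  left_inv := by
    rintro ⟨Y, rfl, h⟩
    simp
  right_inv := by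
    rintro ⟨W, ⟨hW, h⟩, heq⟩
    apply Subtype.ext
    change W.take k ++ W.take k = W
    nth_rewrite 2 [heq]
    rw [List.take_append_drop]

theorem aCount_eq_card_noBifixUpTo (q : ℕ) {n k : ℕ} (hk : k < n) (hk' : n ≤ 2 * k + 1) :
    aCount q n = Nat.card {W : List (Fin q) // W.length = n ∧ NoBifixUpTo k W} := by
  rw [aCount, if_neg (by omega)]
  refine Nat.card_congr (Equiv.subtypeEquivRight fun W => and_congr_right fun hW => ?_)
  exact bifixFree_iff_noBifixUpTo_half (by omega) (by omega)

theorem card_noBifixUpTo_succ (q : ℕ) {n k : ℕ} (hk : 2 * k ≤ n) :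
    Nat.card {W : List (Fin q) // W.length = n + 1 ∧ NoBifixUpTo k W} =
      q * Nat.card {W : List (Fin q) // W.length = n ∧ NoBifixUpTo k W} := by
  rw [← Nat.card_congr (insertMiddleEquiv hk), Nat.card_prod, Nat.card_fin]

theorem card_noBifixUpTo_pred (q : ℕ) {k : ℕ} (hk : 1 ≤ k) :
    Nat.card {W : List (Fin q) // W.length = 2 * k ∧ NoBifixUpTo (k - 1) W} =
      aCount q (2 * k) + aCount q k := by
  classical
  have hfin (P : List (Fin q) → Prop) (hP : ∀ W, P W → W.length = 2 * k) : Finite {W // P W} :=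
    (List.finite_length_eq (Fin q) (2 * k)).subset hP
  have := hfin (fun W => (W.length = 2 * k ∧ NoBifixUpTo (k - 1) W) ∧ W.take k = W.drop k)
    fun W h => h.1.1
  have := hfin (fun W => (W.length = 2 * k ∧ NoBifixUpTo (k - 1) W) ∧ ¬ W.take k = W.drop k)
    fun W h => h.1.1
  have hsplit := Nat.card_congr (Equiv.sumCompl
    fun W : {W : List (Fin q) // W.length = 2 * k ∧ NoBifixUpTo (k - 1) W} =>
      W.1.take k = W.1.drop k)
  rw [← hsplit, Nat.card_congr (Equiv.sumCongr
    (Equiv.subtypeSubtypeEquivSubtypeInter _ fun W : List (Fin q) => W.take k = W.drop k)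
    (Equiv.subtypeSubtypeEquivSubtypeInter _ fun W : List (Fin q) => ¬ W.take k = W.drop k)),
    Nat.card_sum, add_comm, aCount_eq_card_noBifixUpTo q (n := 2 * k) (k := k) (by omega) (by omega),
    aCount, if_neg (by omega), Nat.card_congr (squareEquiv hk)]
  congr 1
  refine Nat.card_congr (Equiv.subtypeEquivRight fun W => ?_)
  rw [and_assoc]
  exact and_congr_right fun hW => (noBifixUpTo_pred_iff hk hW).symm

theorem aCount_one (q : ℕ) : aCount q 1 = q := by
  rw [aCount_eq_card_noBifixUpTo q (k := 0) (by omega) (by omega),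
    card_noBifixUpTo_succ q (by omega)]
  have : Nat.card {W : List (Fin q) // W.length = 0 ∧ NoBifixUpTo 0 W} = 1 := by
    rw [Nat.card_eq_one_iff_unique]
    refine ⟨⟨fun V W => Subtype.ext ?_⟩, ⟨⟨[], rfl, fun m hm hm' => by omega⟩⟩⟩
    rw [List.length_eq_zero_iff.mp V.2.1, List.length_eq_zero_iff.mp W.2.1]
  rw [this, mul_one]

/-- The recursion for the number of bifix-free words. -/
theorem aCount_recursion (q : ℕ) (hq : 1 ≤ q) :
    aCount q 0 = 0 ∧
    aCount q 1 = q ∧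
    (∀ k : ℕ, 1 ≤ k →
      (aCount q (2 * k) : ℤ) = q * aCount q (2 * k - 1) - aCount q k) ∧
    (∀ k : ℕ, 1 ≤ k → aCount q (2 * k + 1) = q * aCount q (2 * k)) := by
  refine ⟨by simp [aCount], aCount_one q, fun k hk => ?_, fun k hk => ?_⟩
  · have h := card_noBifixUpTo_pred q hk
    rw [show 2 * k = 2 * k - 1 + 1 by omega, card_noBifixUpTo_succ q (by omega),
      ← aCount_eq_card_noBifixUpTo q (by omega) (by omega),
      show 2 * k - 1 + 1 = 2 * k by omega] at h
    zify at h
    linarith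
  · rw [aCount_eq_card_noBifixUpTo q (k := k) (by omega) (by omega),
      card_noBifixUpTo_succ q le_rfl, ← aCount_eq_card_noBifixUpTo q (by omega) (by omega)]
end

section
/- For all integers q ≥ 1 and M ≥ 1, the number of words of length M over the alphabet [q] that are Z_2-instances equals ∑_{ℓ=1}^{⌈M/2⌉−1} a_ℓ · q^{M−2ℓ} (an empty sum, equal to 0, when M ≤ 2). -/
/-- A word is a `Z₂`-instance if it has the form `ABA` with `A, B` nonempty. -/
def Z2Instance {α : Type*} (W : List α) : Prop :=
  ∃ A B : List α, A ≠ [] ∧ B ≠ [] ∧ W = A ++ B ++ A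

/-- `z2InstCount q n` is the number of length-`n` `Z₂`-instances over a
`q`-letter alphabet. -/
noncomputable def z2InstCount (q n : ℕ) : ℕ :=
  Nat.card {W : List (Fin q) // W.length = n ∧ Z2Instance W}

/-- A factorization `W = ABA` can be refined to one in which the outer factor is bifix-free. -/
theorem exists_bifixFree_factorization {α : Type*} (A B : List α) (hA : A ≠ []) (hB : B ≠ []) :
    ∃ C D : List α, C ≠ [] ∧ D ≠ [] ∧ BifixFree C ∧ A ++ B ++ A = C ++ D ++ C := by
  by_cases h : BifixFree A
  · exact ⟨A, B, hA, hB, h, rfl⟩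
  · simp only [BifixFree, not_forall, not_not] at h
    obtain ⟨V, hV, ⟨X, hX, hAX⟩, ⟨Y, hY, hAY⟩⟩ := h
    have hlt : V.length < A.length := by
      rw [hAX, List.length_append]
      have := List.length_pos_iff.mpr hX
      omega
    obtain ⟨C, D, hC, hD, hf, he⟩ :=
      exists_bifixFree_factorization V (X ++ B ++ Y) hV (by simp [hX])
    refine ⟨C, D, hC, hD, hf, ?_⟩
    rw [← he]
    calc A ++ B ++ A = (V ++ X) ++ B ++ (Y ++ V) := by rw [← hAX, ← hAY]
      _ = V ++ (X ++ B ++ Y) ++ V := by simp only [List.append_assoc]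
termination_by A.length

/-- If `ABA = CDC` with `A` nonempty and `C` bifix-free, then `A` is at least as long as `C`. -/
theorem BifixFree.length_le {α : Type*} {A B C D : List α} (hA : A ≠ []) (hC : BifixFree C)
    (h : A ++ B ++ A = C ++ D ++ C) : C.length ≤ A.length := by
  by_contra! hlt
  obtain ⟨X, hX⟩ : A <+: C := List.prefix_of_prefix_length_le
    (l₃ := A ++ B ++ A) ⟨B ++ A, by simp⟩ ⟨D ++ C, by simp [h]⟩ hlt.le
  obtain ⟨Y, hY⟩ : A <:+ C := List.suffix_of_suffix_length_le
    (l₃ := A ++ B ++ A) ⟨A ++ B, rfl⟩ ⟨C ++ D, h.symm⟩ hlt.le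
  refine hC A ⟨hA, ⟨X, ?_, hX.symm⟩, ⟨Y, ?_, hY.symm⟩⟩
  · rintro rfl
    simp [← hX] at hlt
  · rintro rfl
    simp [← hY] at hlt

/-- The factorization `W = ABA` with bifix-free outer factor is unique. -/
theorem BifixFree.factorization_unique {α : Type*} {A B C D : List α} (hA : A ≠ [])
    (hC : C ≠ []) (hfA : BifixFree A) (hfC : BifixFree C)
    (h : A ++ B ++ A = C ++ D ++ C) : A = C ∧ B = D := by
  have hl : A.length = C.length :=
    le_antisymm (hfA.length_le hC h.symm) (hfC.length_le hA h)
  simp only [List.append_assoc] at h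
  obtain ⟨rfl, h'⟩ := List.append_inj h hl
  exact ⟨rfl, List.append_cancel_right h'⟩

/-- The number of length-`M` words over `[q]` that are `Z₂`-instances equals
`∑_{ℓ=1}^{⌈M/2⌉−1} a_ℓ q^{M−2ℓ}`.  (Here `⌈M/2⌉ = (M+1)/2` in natural division,
and the sum is empty for `M ≤ 2`.) -/
theorem z2InstCount_eq (q M : ℕ) (hq : 1 ≤ q) (hM : 1 ≤ M) :
    z2InstCount q M = ∑ ℓ ∈ Finset.Ico 1 ((M + 1) / 2), aCount q ℓ * q ^ (M - 2 * ℓ) := by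
  let F (ℓ : ℕ) : Type :=
    {A : List (Fin q) // A.length = ℓ ∧ BifixFree A} × List.Vector (Fin q) (M - 2 * ℓ)
  have hfin (ℓ : ℕ) : Finite {A : List (Fin q) // A.length = ℓ ∧ BifixFree A} :=
    (List.finite_length_eq (Fin q) ℓ).subset fun _ h => h.1
  have hF (ℓ : ℕ) : Finite (F ℓ) := inferInstanceAs (Finite (_ × _))
  have hcard (ℓ : ℕ) (hℓ : ℓ ∈ Finset.Ico 1 ((M + 1) / 2)) :
      Nat.card (F ℓ) = aCount q ℓ * q ^ (M - 2 * ℓ) := by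
    have h0 : ℓ ≠ 0 := by
      rw [Finset.mem_Ico] at hℓ
      omega
    simp [F, aCount, h0, Nat.card_prod]
  rw [← Finset.sum_congr rfl hcard, ← Finset.sum_coe_sort, ← Nat.card_sigma, z2InstCount]
  symm
  let f : (Σ ℓ : Finset.Ico 1 ((M + 1) / 2), F ℓ) →
      {W : List (Fin q) // W.length = M ∧ Z2Instance W} := fun x =>
    ⟨x.2.1.1 ++ x.2.2.1 ++ x.2.1.1, by
      obtain ⟨⟨ℓ, hℓ⟩, ⟨A, hA, -⟩, ⟨B, hB⟩⟩ := x
      rw [Finset.mem_Ico] at hℓ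
      dsimp only at hA hB ⊢
      refine ⟨by simp only [List.length_append]; omega, A, B, ?_, ?_, rfl⟩
      · exact List.length_pos_iff.mp (by omega)
      · exact List.length_pos_iff.mp (by omega)⟩
  refine Nat.card_eq_of_bijective f ⟨?_, ?_⟩
  · rintro ⟨⟨ℓ, hℓ⟩, ⟨A, hA, hfA⟩, ⟨B, hB⟩⟩ ⟨⟨k, hk⟩, ⟨C, hC, hfC⟩, ⟨D, hD⟩⟩ h
    have hℓ' := Finset.mem_Ico.mp hℓ
    have hk' := Finset.mem_Ico.mp hk
    dsimp only at hA hC hB hD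
    obtain ⟨rfl, rfl⟩ := BifixFree.factorization_unique
      (List.length_pos_iff.mp (by omega)) (List.length_pos_iff.mp (by omega)) hfA hfC
      (congrArg Subtype.val h)
    subst hA
    subst hC
    rfl
  · rintro ⟨W, hW, A, B, hA, hB, rfl⟩
    obtain ⟨C, D, hC, hD, hf, he⟩ := exists_bifixFree_factorization A B hA hB
    have hC' := List.length_pos_iff.mpr hC
    have hD' := List.length_pos_iff.mpr hD
    rw [he] at hW
    simp only [List.length_append] at hW
    exact ⟨⟨⟨C.length, Finset.mem_Ico.mpr (by omega)⟩, ⟨C, rfl, hf⟩, ⟨D, by dsimp only; omega⟩⟩,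
      Subtype.ext he.symm⟩
end

section
/- For every integer q ≥ 2 and every real number x with 0 ≤ x < 1/q, the series ∑_{ℓ=1}^∞ a_ℓ x^ℓ and the series ∑_{j=0}^∞ (−1)^j q x^{2^j} / ∏_{k=0}^{j} (1 − q x^{2^k}) both converge, and they are equal. -/
section Bifix

variable {α : Type*}

lemma IsBifix.length_lt {V W : List α} (h : IsBifix V W) : V.length < W.length := by
  obtain ⟨-, ⟨A, hA, rfl⟩, -⟩ := h
  simpa [List.length_pos_iff] using hA

lemma IsBifix.trans {U V W : List α} (h₁ : IsBifix U V) (h₂ : IsBifix V W) : IsBifix U W := by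
  obtain ⟨hU, ⟨A, hA, rfl⟩, ⟨B, hB, hAB⟩⟩ := h₁
  obtain ⟨-, ⟨C, hC, rfl⟩, ⟨D, hD, hCD⟩⟩ := h₂
  refine ⟨hU, ⟨A ++ C, by simp [hA], by simp⟩, ⟨D ++ B, by simp [hB], ?_⟩⟩
  rw [hCD, hAB, List.append_assoc]

lemma isBifix_append_append {V : List α} (hV : V ≠ []) (U : List α) :
    IsBifix V (V ++ (U ++ V)) :=
  ⟨hV, ⟨U ++ V, by simp [hV], rfl⟩, ⟨V ++ U, by simp [hV], by simp⟩⟩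

/-- Two borders of the same word are comparable: the shorter one is a bifix of the longer one. -/
lemma isBifix_of_length_lt {V V' A A' B B' : List α} (hV : V ≠ []) (hA : V ++ A = V' ++ A')
    (hB : B ++ V = B' ++ V') (hlt : V.length < V'.length) : IsBifix V V' := by
  obtain ⟨C, rfl⟩ : V <+: V' :=
    List.prefix_of_prefix_length_le ⟨A, rfl⟩ ⟨A', hA.symm⟩ hlt.le
  obtain ⟨D, hD⟩ : V <:+ V ++ C :=
    List.suffix_of_suffix_length_le ⟨B, rfl⟩ ⟨B', hB.symm⟩ hlt.le
  refine ⟨hV, ⟨C, ?_, rfl⟩, ⟨D, ?_, hD.symm⟩⟩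
  · rintro rfl
    simp at hlt
  · rintro rfl
    rw [← hD] at hlt
    simp at hlt

/-- A word with a bifix has a bifix-free bifix that does not overlap itself. -/
lemma exists_eq_append_of_not_bifixFree {W : List α} (hW : ¬ BifixFree W) :
    ∃ V U, V ≠ [] ∧ BifixFree V ∧ W = V ++ (U ++ V) := by
  have hex : ∃ n V, IsBifix V W ∧ V.length = n := by
    simp only [BifixFree, not_forall, not_not] at hW
    obtain ⟨V, hV⟩ := hW
    exact ⟨_, V, hV, rfl⟩
  classical
  obtain ⟨V, hV, hlen⟩ := Nat.find_spec hex
  have hfree : BifixFree V := fun U hU =>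
    Nat.find_min hex (hlen ▸ hU.length_lt) ⟨U, hU.trans hV, rfl⟩
  obtain ⟨hne, ⟨A, hA, hWA⟩, ⟨B, hB, hWB⟩⟩ := hV
  refine ⟨V, ?_⟩
  rcases List.append_eq_append_iff.1 (hWA.symm.trans hWB) with ⟨U, rfl, -⟩ | ⟨C, hVB, hVA⟩
  · exact ⟨U, hne, hfree, by rw [hWB, List.append_assoc]⟩
  · rcases eq_or_ne C [] with rfl | hC
    · exact ⟨[], hne, hfree, by simp_all⟩
    · exact (hfree C ⟨hC, ⟨A, hA, hVA⟩, ⟨B, hB, hVB⟩⟩).elim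

/-- A nonempty word is either bifix-free or uniquely of the form `VUV` with `V` nonempty and
bifix-free. -/
noncomputable def bifixEquiv (α : Type*) :
    {W : List α // W ≠ [] ∧ BifixFree W} ⊕ {W : List α // W ≠ [] ∧ BifixFree W} × List α ≃
      {W : List α // W ≠ []} :=
  Equiv.ofBijective
    (Sum.elim (fun V => ⟨V.1, V.2.1⟩) fun p => ⟨p.1.1 ++ (p.2 ++ p.1.1), by simp [p.1.2.1]⟩) <| by
    constructor
    · refine Function.Injective.sumElim ?_ ?_ ?_
      · intro V V' h
        simpa [Subtype.ext_iff] using h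
      · rintro ⟨⟨V, hV, hVf⟩, U⟩ ⟨⟨V', hV', hVf'⟩, U'⟩ h
        have h : V ++ (U ++ V) = V' ++ (U' ++ V') := congrArg Subtype.val h
        have h' : (V ++ U) ++ V = (V' ++ U') ++ V' := by simpa using h
        have hlen : V.length = V'.length := by
          rcases lt_trichotomy V.length V'.length with hlt | heq | hlt
          · exact (hVf' V (isBifix_of_length_lt hV h h' hlt)).elim
          · exact heq
          · exact (hVf V' (isBifix_of_length_lt hV' h.symm h'.symm hlt)).elim
        obtain ⟨rfl, h⟩ := List.append_inj h hlen
        obtain rfl := List.append_cancel_right h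
        rfl
      · rintro ⟨V, hV, hVf⟩ ⟨⟨V', hV', hVf'⟩, U⟩ h
        have h : V = V' ++ (U ++ V') := congrArg Subtype.val h
        exact hVf V' (h ▸ isBifix_append_append hV' U)
    · rintro ⟨W, hW⟩
      by_cases hf : BifixFree W
      · exact ⟨.inl ⟨W, hW, hf⟩, rfl⟩
      · obtain ⟨V, U, hV, hVf, rfl⟩ := exists_eq_append_of_not_bifixFree hf
        exact ⟨.inr (⟨V, hV, hVf⟩, U), rfl⟩

end Bifix

section WordSeries

variable {q : ℕ} {x : ℝ}

lemma natCard_words (q n : ℕ) : Nat.card {W : List (Fin q) // W.length = n} = q ^ n := by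
  change Nat.card (List.Vector (Fin q) n) = q ^ n
  rw [Nat.card_eq_fintype_card, card_vector, Fintype.card_fin]

lemma summable_words (hx0 : 0 ≤ x) (hx : q * x < 1) :
    Summable fun W : List (Fin q) => x ^ W.length := by
  rw [← (Equiv.sigmaFiberEquiv (List.length : List (Fin q) → ℕ)).summable_iff,
    summable_sigma_of_nonneg fun _ => by exact pow_nonneg hx0 _]
  have hfin (n : ℕ) : Finite {W : List (Fin q) // W.length = n} :=
    inferInstanceAs (Finite (List.Vector (Fin q) n))
  refine ⟨fun n => Summable.of_finite, ?_⟩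
  convert summable_geometric_of_lt_one (mul_nonneg q.cast_nonneg hx0) hx with n
  calc ∑' W : {W : List (Fin q) // W.length = n}, x ^ W.1.length
      = ∑' _ : {W : List (Fin q) // W.length = n}, x ^ n := tsum_congr fun W => by rw [W.2]
    _ = (q * x) ^ n := by rw [tsum_const, natCard_words, nsmul_eq_mul, mul_pow, Nat.cast_pow]

lemma summable_words_subtype (p : List (Fin q) → Prop) (hx0 : 0 ≤ x) (hx : q * x < 1) :
    Summable fun W : {W // p W} => x ^ W.1.length :=
  (summable_words hx0 hx).comp_injective Subtype.val_injective

/-- The sum of `x ^ |W|` over a family of words is the generating function of its counts. -/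
lemma hasSum_natCard_mul_pow (p : List (Fin q) → Prop) (hx0 : 0 ≤ x) (hx : q * x < 1) :
    HasSum (fun n => (Nat.card {W : List (Fin q) // W.length = n ∧ p W} : ℝ) * x ^ n)
      (∑' W : {W // p W}, x ^ W.1.length) := by
  refine ((summable_words_subtype p hx0 hx).hasSum.tsum_fiberwise
    fun W : {W // p W} => W.1.length).congr_fun fun n => ?_
  have e : ((fun W : {W // p W} => W.1.length) ⁻¹' {n} : Set _) ≃
      {W : List (Fin q) // W.length = n ∧ p W} :=
    (Equiv.subtypeSubtypeEquivSubtypeInter p (fun W => W.length = n)).trans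
      (Equiv.subtypeEquivRight fun _ => and_comm)
  rw [← Nat.card_congr e, ← nsmul_eq_mul, ← tsum_const]
  exact tsum_congr fun W => by rw [show W.1.1.length = n from W.2]

lemma hasSum_natCard_mul_pow_succ {p : List (Fin q) → Prop} (hp : ¬ p []) (hx0 : 0 ≤ x)
    (hx : q * x < 1) :
    HasSum (fun n => (Nat.card {W : List (Fin q) // W.length = n + 1 ∧ p W} : ℝ) * x ^ (n + 1))
      (∑' W : {W // p W}, x ^ W.1.length) := by
  have : IsEmpty {W : List (Fin q) // W.length = 0 ∧ p W} :=
    ⟨fun ⟨W, hW, hpW⟩ => hp (List.eq_nil_of_length_eq_zero hW ▸ hpW)⟩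
  rw [hasSum_nat_add_iff (f := fun n =>
    (Nat.card {W : List (Fin q) // W.length = n ∧ p W} : ℝ) * x ^ n) 1]
  simpa only [Finset.sum_range_one, Nat.card_of_isEmpty, Nat.cast_zero, zero_mul, add_zero] using
    hasSum_natCard_mul_pow p hx0 hx

lemma tsum_words (hx0 : 0 ≤ x) (hx : q * x < 1) :
    ∑' W : List (Fin q), x ^ W.length = (1 - q * x)⁻¹ := by
  have h := hasSum_natCard_mul_pow (q := q) (fun _ => True) hx0 hx
  simp only [and_true, natCard_words, Nat.cast_pow, ← mul_pow] at h
  rw [← (Equiv.subtypeUnivEquiv fun _ => trivial).tsum_eq (fun W : List (Fin q) => x ^ W.length)]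
  exact h.unique (hasSum_geometric_of_lt_one (by positivity) hx)

lemma tsum_words_ne_nil (hx0 : 0 ≤ x) (hx : q * x < 1) :
    ∑' W : {W : List (Fin q) // W ≠ []}, x ^ W.1.length = q * x * (1 - q * x)⁻¹ := by
  have h := hasSum_natCard_mul_pow_succ (q := q) (p := (· ≠ [])) (by simp) hx0 hx
  have hcard (n : ℕ) :
      Nat.card {W : List (Fin q) // W.length = n + 1 ∧ W ≠ []} = q ^ (n + 1) := by
    rw [← natCard_words]
    refine Nat.card_congr (Equiv.subtypeEquivRight fun W => and_iff_left_of_imp ?_)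
    rintro hW rfl
    simp at hW
  simp only [hcard, Nat.cast_pow, ← mul_pow] at h
  simp only [pow_succ'] at h
  exact h.unique ((hasSum_geometric_of_lt_one (by positivity) hx).mul_left _)

/-- The generating function of nonempty bifix-free words. -/
noncomputable def bifixGenFun (q : ℕ) (x : ℝ) : ℝ :=
  ∑' W : {W : List (Fin q) // W ≠ [] ∧ BifixFree W}, x ^ W.1.length

lemma hasSum_aCount (hx0 : 0 ≤ x) (hx : q * x < 1) :
    HasSum (fun ℓ => (aCount q (ℓ + 1) : ℝ) * x ^ (ℓ + 1)) (bifixGenFun q x) := by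
  refine (hasSum_natCard_mul_pow_succ (q := q) (p := fun W => W ≠ [] ∧ BifixFree W) (by simp)
    hx0 hx).congr_fun fun n => ?_
  congr 2
  rw [aCount, if_neg n.succ_ne_zero]
  refine Nat.card_congr (Equiv.subtypeEquivRight fun W => ?_)
  refine and_congr_right fun hW => (and_iff_right ?_).symm
  rintro rfl
  simp at hW

lemma bifixGenFun_nonneg (hx0 : 0 ≤ x) : 0 ≤ bifixGenFun q x :=
  tsum_nonneg fun _ => pow_nonneg hx0 _

lemma bifixGenFun_functional_equation (hx0 : 0 ≤ x) (hx1 : x ≤ 1) (hx : q * x < 1) :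
    bifixGenFun q x + bifixGenFun q (x ^ 2) * (1 - q * x)⁻¹ = q * x * (1 - q * x)⁻¹ := by
  have hsq : q * x ^ 2 < 1 :=
    (mul_le_mul_of_nonneg_left (pow_le_of_le_one hx0 hx1 two_ne_zero) q.cast_nonneg).trans_lt hx
  have hP := summable_words_subtype (fun W : List (Fin q) => W ≠ [] ∧ BifixFree W) hx0 hx
  have hP2 := summable_words_subtype (fun W : List (Fin q) => W ≠ [] ∧ BifixFree W)
    (sq_nonneg x) hsq
  have hL := summable_words (q := q) hx0 hx
  have hprod := hP2.mul_of_nonneg hL (fun _ => pow_nonneg (sq_nonneg x) _)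
    (fun _ => pow_nonneg hx0 _)
  have hpow (p : {W : List (Fin q) // W ≠ [] ∧ BifixFree W} × List (Fin q)) :
      x ^ (bifixEquiv (Fin q) (.inr p)).1.length = (x ^ 2) ^ p.1.1.length * x ^ p.2.length := by
    change x ^ (p.1.1 ++ (p.2 ++ p.1.1)).length = _
    simp only [List.length_append]
    ring
  rw [← tsum_words_ne_nil hx0 hx, ← tsum_words hx0 hx, bifixGenFun, bifixGenFun,
    hP2.tsum_mul_tsum hL hprod, ← (bifixEquiv (Fin q)).tsum_eq, Summable.tsum_sum]
  · exact congrArg₂ _ rfl (tsum_congr fun p => (hpow p).symm)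
  · exact hP
  · exact hprod.congr fun p => (hpow p).symm

lemma bifixGenFun_le (hx0 : 0 ≤ x) (hx1 : x ≤ 1) (hx : q * x < 1) :
    bifixGenFun q x ≤ q * x / (1 - q * x) := by
  rw [div_eq_mul_inv, ← bifixGenFun_functional_equation hx0 hx1 hx]
  exact le_add_of_nonneg_right
    (mul_nonneg (bifixGenFun_nonneg (sq_nonneg x)) (inv_nonneg.2 (sub_nonneg.2 hx.le)))

end WordSeries

/-- The general term of the alternating series. -/
noncomputable def seriesTerm (q : ℕ) (x : ℝ) (j : ℕ) : ℝ :=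
  (-1 : ℝ) ^ j * q * x ^ (2 ^ j) / ∏ k ∈ Finset.range (j + 1), (1 - q * x ^ (2 ^ k))

section Series

variable {q : ℕ} {x : ℝ}

lemma mul_pow_two_pow_lt_one (hx0 : 0 ≤ x) (hx1 : x ≤ 1) (hx : q * x < 1) (k : ℕ) :
    q * x ^ (2 ^ k) < 1 :=
  (mul_le_mul_of_nonneg_left (pow_le_of_le_one hx0 hx1 (by positivity)) q.cast_nonneg).trans_lt hx

lemma prod_one_sub_pos (hx0 : 0 ≤ x) (hx1 : x ≤ 1) (hx : q * x < 1) (n : ℕ) :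
    0 < ∏ k ∈ Finset.range n, (1 - q * x ^ (2 ^ k)) :=
  Finset.prod_pos fun k _ => sub_pos.2 (mul_pow_two_pow_lt_one hx0 hx1 hx k)

lemma norm_seriesTerm (hx0 : 0 ≤ x) (hx1 : x ≤ 1) (hx : q * x < 1) (j : ℕ) :
    ‖seriesTerm q x j‖ =
      q * x ^ (2 ^ j) / ∏ k ∈ Finset.range (j + 1), (1 - q * x ^ (2 ^ k)) := by
  rw [seriesTerm, norm_div, Real.norm_of_nonneg (prod_one_sub_pos hx0 hx1 hx _).le, mul_assoc,
    norm_mul, norm_pow, norm_neg, norm_one, one_pow, one_mul, Real.norm_of_nonneg (by positivity)]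

lemma summable_seriesTerm (hx0 : 0 ≤ x) (hx2 : x < 1 / 2) (hx : q * x < 1) :
    Summable (seriesTerm q x) := by
  have hx1 : x ≤ 1 := by linarith
  refine summable_of_ratio_norm_eventually_le (r := x / (1 - x))
    ((div_lt_one (by linarith)).2 (by linarith)) (.of_forall fun j => ?_)
  have hD := prod_one_sub_pos hx0 hx1 hx (j + 1)
  have hlt := mul_pow_two_pow_lt_one hx0 hx1 hx (j + 1)
  have hle : x ^ (2 ^ j) ≤ x := pow_le_of_le_one hx0 hx1 (by positivity)
  have hq : q * x ^ (2 ^ (j + 1)) ≤ x :=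
    calc (q : ℝ) * x ^ (2 ^ (j + 1)) = q * x ^ (2 ^ j) * x ^ (2 ^ j) := by ring
      _ ≤ 1 * x := mul_le_mul (mul_pow_two_pow_lt_one hx0 hx1 hx j).le hle (by positivity) (by simp)
      _ = x := one_mul x
  have hratio : x ^ (2 ^ j) / (1 - q * x ^ (2 ^ (j + 1))) ≤ x / (1 - x) :=
    div_le_div₀ hx0 hle (by linarith) (by linarith)
  rw [norm_seriesTerm hx0 hx1 hx, norm_seriesTerm hx0 hx1 hx, Finset.prod_range_succ _ (j + 1)]
  calc _ = x ^ (2 ^ j) / (1 - q * x ^ (2 ^ (j + 1))) *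
        (q * x ^ (2 ^ j) / ∏ k ∈ Finset.range (j + 1), (1 - q * x ^ (2 ^ k))) := by
        rw [div_mul_div_comm, mul_comm (∏ k ∈ _, _)]
        congr 1
        ring
    _ ≤ _ := mul_le_mul_of_nonneg_right hratio (by positivity)

lemma bifixGenFun_eq_sum_add (hx0 : 0 ≤ x) (hx1 : x ≤ 1) (hx : q * x < 1) (n : ℕ) :
    bifixGenFun q x = ∑ j ∈ Finset.range n, seriesTerm q x j +
      (-1) ^ n * bifixGenFun q (x ^ (2 ^ n)) /
        ∏ k ∈ Finset.range n, (1 - q * x ^ (2 ^ k)) := by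
  induction n with
  | zero => simp
  | succ n ih =>
    have hn := mul_pow_two_pow_lt_one hx0 hx1 hx n
    have hfe := bifixGenFun_functional_equation (q := q) (pow_nonneg hx0 (2 ^ n))
      (pow_le_one₀ hx0 hx1) hn
    rw [← pow_mul, ← pow_succ] at hfe
    have hD := (prod_one_sub_pos hx0 hx1 hx n).ne'
    have hf : 1 - q * x ^ (2 ^ n) ≠ 0 := (sub_pos.2 hn).ne'
    rw [ih, Finset.sum_range_succ, add_assoc, seriesTerm, Finset.prod_range_succ,
      eq_sub_of_add_eq hfe]
    congr 1
    field_simp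
    ring

lemma bifixGenFun_eq_tsum (hx0 : 0 ≤ x) (hx2 : x < 1 / 2) (hx : q * x < 1) :
    bifixGenFun q x = ∑' j, seriesTerm q x j := by
  have hx1 : x ≤ 1 := by linarith
  have hs := summable_seriesTerm hx0 hx2 hx
  refine tendsto_nhds_unique ?_ hs.hasSum.tendsto_sum_nat
  rw [← tendsto_sub_nhds_zero_iff]
  refine squeeze_zero_norm (fun n => ?_) (tendsto_zero_iff_norm_tendsto_zero.1
    hs.tendsto_atTop_zero)
  have hD := prod_one_sub_pos hx0 hx1 hx n
  rw [norm_sub_rev, bifixGenFun_eq_sum_add hx0 hx1 hx n, add_sub_cancel_left, norm_div,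
    Real.norm_of_nonneg hD.le, norm_mul, norm_pow, norm_neg, norm_one, one_pow, one_mul,
    Real.norm_of_nonneg (bifixGenFun_nonneg (pow_nonneg hx0 _)), norm_seriesTerm hx0 hx1 hx,
    Finset.prod_range_succ, mul_comm (∏ k ∈ _, _), ← div_div]
  exact div_le_div_of_nonneg_right (bifixGenFun_le (pow_nonneg hx0 _) (pow_le_one₀ hx0 hx1)
    (mul_pow_two_pow_lt_one hx0 hx1 hx n)) hD.le

end Series

/-- For `q ≥ 2` and `0 ≤ x < 1/q`, the generating function of the bifix-free
counts equals the alternating series `∑_{j≥0} (−1)^j q x^{2^j} / ∏_{k=0}^{j} (1 − q x^{2^k})`,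
and both series converge. -/
theorem genFun_eq_series (q : ℕ) (hq : 2 ≤ q) (x : ℝ) (hx0 : 0 ≤ x) (hx : x < 1 / q) :
    Summable (fun ℓ : ℕ => (aCount q (ℓ + 1) : ℝ) * x ^ (ℓ + 1)) ∧
    Summable (fun j : ℕ =>
      (-1 : ℝ) ^ j * q * x ^ (2 ^ j) / ∏ k ∈ Finset.range (j + 1), (1 - q * x ^ (2 ^ k))) ∧
    (∑' ℓ : ℕ, (aCount q (ℓ + 1) : ℝ) * x ^ (ℓ + 1)) =
      ∑' j : ℕ,
        (-1 : ℝ) ^ j * q * x ^ (2 ^ j) / ∏ k ∈ Finset.range (j + 1), (1 - q * x ^ (2 ^ k)) := by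
  have hq' : (2 : ℝ) ≤ q := by exact_mod_cast hq
  have hqx : q * x < 1 := by rwa [lt_div_iff₀' (by linarith)] at hx
  have hx2 : x < 1 / 2 := hx.trans_le (one_div_le_one_div_of_le two_pos hq')
  have ha := hasSum_aCount hx0 hqx
  exact ⟨ha.summable, summable_seriesTerm hx0 hx2 hqx,
    ha.tsum_eq.trans (bifixGenFun_eq_tsum hx0 hx2 hqx)⟩
end

section
/- For every integer q ≥ 2, the limit lim_{n→∞} II_n(Z_2, q) exists, the series ∑_{j=0}^∞ (−1)^j q^{1−2^{j+1}} / ∏_{k=0}^{j} (1 − q^{1−2^{k+1}}) converges, and lim_{n→∞} II_n(Z_2, q) = ∑_{j=0}^∞ (−1)^j q^{1−2^{j+1}} / ∏_{k=0}^{j} (1 − q^{1−2^{k+1}}). -/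
/-- `instProb2 q n` is the probability that a uniformly random word of length `n`
over a `q`-letter alphabet is a `Z₂`-instance. -/
noncomputable def instProb2 (q n : ℕ) : ℝ :=
  (Nat.card {W : List (Fin q) // W.length = n ∧ Z2Instance W} : ℝ) / (q : ℝ) ^ n

/-- Term `i` of the series for the asymptotic `Z₂`-instance probability. -/
noncomputable def Fterm (q : ℕ) (i : ℕ) : ℝ :=
  (-1 : ℝ) ^ i * (q : ℝ) ^ ((1 : ℤ) - 2 ^ (i + 1)) /
    ∏ k ∈ Finset.range (i + 1), (1 - (q : ℝ) ^ ((1 : ℤ) - 2 ^ (k + 1)))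

/-- A word is bordered if it has a nonempty proper prefix that is also a suffix. -/
def IsBordered {α : Type*} (W : List α) : Prop :=
  ∃ C : List α, C ≠ [] ∧ C ≠ W ∧ C <+: W ∧ C <:+ W

section Borders

variable {α : Type*}

lemma exists_eq_append_or_isBordered {C W : List α} (hne : C ≠ W) (hp : C <+: W)
    (hs : C <:+ W) : (∃ B, W = C ++ B ++ C) ∨ IsBordered C := by
  obtain ⟨X, hX⟩ := hp
  obtain ⟨Y, hY⟩ := hs
  have h : C ++ X = Y ++ C := hX.trans hY.symm
  rcases List.append_eq_append_iff.1 h with ⟨Z, h1, h2⟩ | ⟨Z, h1, h2⟩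
  · left
    exact ⟨Z, by rw [← hY, h1]⟩
  · by_cases hZ : Z = []
    · left
      subst hZ
      refine ⟨[], ?_⟩
      simp only [List.append_nil] at h1 ⊢
      rw [← hY, ← h1]
    · right
      refine ⟨Z, hZ, ?_, ⟨X, h2.symm⟩, ⟨Y, h1.symm⟩⟩
      rintro rfl
      have hYnil : Y = [] := by simpa using h1
      subst hYnil
      exact hne (by simpa using hY)

lemma IsBordered.exists_not_isBordered {W : List α} (hW : IsBordered W) :
    ∃ A B : List α, A ≠ [] ∧ ¬ IsBordered A ∧ W = A ++ B ++ A := by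
  induction hn : W.length using Nat.strong_induction_on generalizing W with
  | _ n ih =>
    obtain ⟨C, hC, hne, hp, hs⟩ := hW
    by_cases hb : IsBordered C
    · have hlt : C.length < n := by
        rw [← hn]
        exact lt_of_le_of_ne hp.length_le fun h => hne (hp.eq_of_length h)
      obtain ⟨A, B, hA, hA', rfl⟩ := ih _ hlt hb rfl
      obtain ⟨X, rfl⟩ := hp
      obtain ⟨Y, hY⟩ := hs
      refine ⟨A, ?_⟩
      have hpre : A <+: A ++ B ++ A ++ X := ⟨B ++ A ++ X, by simp⟩
      have hsuf : A <:+ A ++ B ++ A ++ X := ⟨Y ++ A ++ B, by rw [← hY]; simp⟩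
      have hAne : A ≠ A ++ B ++ A ++ X := by
        intro h
        have hlen := congrArg List.length h
        have := List.length_pos_iff.2 hA
        simp only [List.length_append] at hlen
        omega
      rcases exists_eq_append_or_isBordered hAne hpre hsuf with ⟨D, hD⟩ | h
      · exact ⟨D, hA, hA', hD⟩
      · exact absurd h hA'
    · rcases exists_eq_append_or_isBordered hne hp hs with ⟨B, h⟩ | h
      · exact ⟨C, B, hC, hb, h⟩
      · exact absurd h hb

lemma isBordered_iff {W : List α} :
    IsBordered W ↔ ∃ A B : List α, A ≠ [] ∧ ¬ IsBordered A ∧ W = A ++ B ++ A := by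
  refine ⟨IsBordered.exists_not_isBordered, ?_⟩
  rintro ⟨A, B, hA, -, rfl⟩
  refine ⟨A, hA, ?_, ⟨B ++ A, by simp⟩, ⟨A ++ B, rfl⟩⟩
  simp [hA]

lemma z2Instance_iff {W : List α} :
    Z2Instance W ↔
      ∃ A B : List α, A ≠ [] ∧ ¬ IsBordered A ∧ B ≠ [] ∧ W = A ++ B ++ A := by
  constructor
  · rintro ⟨A, B, hA, hB, rfl⟩
    by_cases hb : IsBordered A
    · obtain ⟨A', B', hA', hb', rfl⟩ := hb.exists_not_isBordered
      exact ⟨A', B' ++ A' ++ B ++ A' ++ B', hA', hb', by simp [hB], by simp⟩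
    · exact ⟨A, B, hA, hb, hB, rfl⟩
  · rintro ⟨A, B, hA, -, hB, rfl⟩
    exact ⟨A, B, hA, hB, rfl⟩

lemma eq_of_append_eq_append_of_not_isBordered {A B A' B' : List α} (hA : A ≠ [])
    (hA' : A' ≠ []) (hb : ¬ IsBordered A) (hb' : ¬ IsBordered A')
    (h : A ++ B ++ A = A' ++ B' ++ A') : A = A' := by
  wlog hle : A.length ≤ A'.length generalizing A B A' B'
  · exact (this hA' hA hb' hb h.symm (by omega)).symm
  by_contra hne
  refine hb' ⟨A, hA, hne, ?_, ?_⟩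
  · exact List.prefix_of_prefix_length_le (l₃ := A ++ B ++ A) ⟨B ++ A, by simp⟩
      ⟨B' ++ A', by simp [h]⟩ hle
  · exact List.suffix_of_suffix_length_le (l₃ := A ++ B ++ A) ⟨A ++ B, rfl⟩
      ⟨A' ++ B', by simp [h]⟩ hle

end Borders

section Counting

open Finset

/-- The words of length `n` over `Fin q`. -/
def wordsOfLength (q n : ℕ) : Finset (List (Fin q)) :=
  (univ : Finset (List.Vector (Fin q) n)).map ⟨List.Vector.toList, Subtype.val_injective⟩

lemma mem_wordsOfLength {q n : ℕ} {W : List (Fin q)} :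
    W ∈ wordsOfLength q n ↔ W.length = n := by
  constructor
  · intro h
    obtain ⟨v, -, rfl⟩ := Finset.mem_map.1 h
    exact v.2
  · intro h
    exact Finset.mem_map.2 ⟨⟨W, h⟩, mem_univ _, rfl⟩

lemma card_wordsOfLength (q n : ℕ) : (wordsOfLength q n).card = q ^ n := by
  simp [wordsOfLength]

open Classical in
/-- The unbordered words of length `n` over `Fin q`. -/
noncomputable def unborderedWords (q n : ℕ) : Finset (List (Fin q)) :=
  (wordsOfLength q n).filter fun W => ¬ IsBordered W

lemma mem_unborderedWords {q n : ℕ} {W : List (Fin q)} :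
    W ∈ unborderedWords q n ↔ W.length = n ∧ ¬ IsBordered W := by
  simp [unborderedWords, mem_wordsOfLength]

open Classical in
/-- The words of length `n` with an unbordered border of length in `[1, L]`. -/
noncomputable def borderedWords (q n L : ℕ) : Finset (List (Fin q)) :=
  (Icc 1 L).biUnion fun l => (unborderedWords q l ×ˢ wordsOfLength q (n - 2 * l)).image
    fun p => p.1 ++ p.2 ++ p.1

lemma mem_borderedWords {q n L : ℕ} (hL : 2 * L ≤ n) {W : List (Fin q)} :
    W ∈ borderedWords q n L ↔ W.length = n ∧ ∃ A B : List (Fin q), A ≠ [] ∧ ¬ IsBordered A ∧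
      A.length ≤ L ∧ W = A ++ B ++ A := by
  simp only [borderedWords, mem_biUnion, mem_Icc, mem_image, mem_product, mem_unborderedWords,
    mem_wordsOfLength, Prod.exists]
  constructor
  · rintro ⟨l, ⟨h1, h2⟩, A, B, ⟨⟨hA, hb⟩, hB⟩, rfl⟩
    refine ⟨by simp; omega, A, B, ?_, hb, by omega, rfl⟩
    rintro rfl
    simp at hA
    omega
  · rintro ⟨hW, A, B, hA, hb, hle, rfl⟩
    have := List.length_pos_iff.2 hA
    simp at hW
    exact ⟨A.length, ⟨by omega, hle⟩, A, B, ⟨⟨rfl, hb⟩, by omega⟩, rfl⟩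

lemma card_borderedWords (q n L : ℕ) :
    (borderedWords q n L).card =
      ∑ l ∈ Icc 1 L, (unborderedWords q l).card * q ^ (n - 2 * l) := by
  classical
  rw [borderedWords, card_biUnion]
  · refine sum_congr rfl fun l _ => ?_
    rw [card_image_of_injOn, card_product, card_wordsOfLength]
    rintro ⟨A, B⟩ h ⟨A', B'⟩ h' heq
    simp only [coe_product, Set.mem_prod, mem_coe, mem_unborderedWords, mem_wordsOfLength] at h h'
    simp only [List.append_assoc] at heq
    obtain ⟨rfl, h2⟩ := List.append_inj heq (h.1.1.trans h'.1.1.symm)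
    obtain ⟨rfl, -⟩ := List.append_inj h2 (h.2.trans h'.2.symm)
    rfl
  · intro l hl l' hl' hne
    simp only [coe_Icc, Set.mem_Icc] at hl hl'
    rw [Function.onFun, disjoint_left]
    intro W h h'
    simp only [mem_image, mem_product, mem_unborderedWords, Prod.exists] at h h'
    obtain ⟨A, B, ⟨⟨hA, hb⟩, -⟩, rfl⟩ := h
    obtain ⟨A', B', ⟨⟨hA', hb'⟩, -⟩, heq⟩ := h'
    refine hne ?_
    rw [← hA, ← hA', eq_of_append_eq_append_of_not_isBordered ?_ ?_ hb hb' heq.symm]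
    · exact List.length_pos_iff.1 (by omega)
    · exact List.length_pos_iff.1 (by omega)

lemma card_unborderedWords_add (q n : ℕ) :
    (unborderedWords q n).card +
      ∑ l ∈ Icc 1 (n / 2), (unborderedWords q l).card * q ^ (n - 2 * l) = q ^ n := by
  classical
  rw [← card_borderedWords, ← card_wordsOfLength, unborderedWords, add_comm,
    ← card_filter_add_card_filter_not (s := wordsOfLength q n) IsBordered]
  congr 2
  ext W
  rw [mem_borderedWords (by omega), mem_filter, mem_wordsOfLength, isBordered_iff]
  refine and_congr_right fun hW => ⟨?_, ?_⟩
  · rintro ⟨A, B, hA, hb, -, h⟩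
    exact ⟨A, B, hA, hb, h⟩
  · rintro ⟨A, B, hA, hb, rfl⟩
    simp at hW
    exact ⟨A, B, hA, hb, by omega, rfl⟩

lemma card_z2Instance (q n : ℕ) :
    Nat.card {W : List (Fin q) // W.length = n ∧ Z2Instance W} =
      ∑ l ∈ Icc 1 ((n - 1) / 2), (unborderedWords q l).card * q ^ (n - 2 * l) := by
  rw [← card_borderedWords, ← Nat.card_eq_finsetCard]
  refine Nat.card_congr (Equiv.subtypeEquivRight fun W => ?_)
  rw [mem_borderedWords (by omega), z2Instance_iff]
  refine and_congr_right fun hW => ⟨?_, ?_⟩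
  · rintro ⟨A, B, hA, hb, hB, rfl⟩
    have := List.length_pos_iff.2 hB
    simp at hW
    exact ⟨A, B, hA, hb, by omega, rfl⟩
  · rintro ⟨A, B, hA, hb, hle, rfl⟩
    have := List.length_pos_iff.2 hA
    refine ⟨A, B, hA, hb, ?_, rfl⟩
    rintro rfl
    simp at hW
    omega

/-- The proportion of unbordered words among the words of length `n` over `q` letters. -/
noncomputable def unborderedDensity (q n : ℕ) : ℝ :=
  ((unborderedWords q n).card : ℝ) / (q : ℝ) ^ n

lemma unborderedDensity_nonneg (q n : ℕ) : 0 ≤ unborderedDensity q n := by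
  unfold unborderedDensity
  positivity

lemma sum_card_mul_pow_div {q n L : ℕ} (hq : 0 < q) (hL : 2 * L ≤ n) :
    ((∑ l ∈ Icc 1 L, (unborderedWords q l).card * q ^ (n - 2 * l) : ℕ) : ℝ) / (q : ℝ) ^ n =
      ∑ l ∈ Icc 1 L, unborderedDensity q l / (q : ℝ) ^ l := by
  have hq' : (q : ℝ) ≠ 0 := by positivity
  push_cast
  rw [sum_div]
  refine sum_congr rfl fun l hl => ?_
  have hl' := (mem_Icc.1 hl).2
  obtain ⟨k, rfl⟩ : ∃ k, n = k + 2 * l := ⟨n - 2 * l, by omega⟩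
  rw [unborderedDensity, Nat.add_sub_cancel, pow_add, two_mul, pow_add]
  field_simp

lemma unborderedDensity_eq {q : ℕ} (hq : 0 < q) (n : ℕ) :
    unborderedDensity q n = 1 - ∑ l ∈ Icc 1 (n / 2), unborderedDensity q l / (q : ℝ) ^ l := by
  have hq' : (q : ℝ) ≠ 0 := by positivity
  have h := card_unborderedWords_add q n
  rw [← sum_card_mul_pow_div hq (n := n) (by omega), unborderedDensity, eq_sub_iff_add_eq,
    ← add_div, ← Nat.cast_add, h, Nat.cast_pow, div_self (pow_ne_zero _ hq')]

lemma instProb2_eq {q : ℕ} (hq : 0 < q) (n : ℕ) :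
    instProb2 q n = ∑ l ∈ Icc 1 ((n - 1) / 2), unborderedDensity q l / (q : ℝ) ^ l := by
  rw [instProb2, card_z2Instance, sum_card_mul_pow_div hq (by omega)]

lemma unborderedDensity_zero {q : ℕ} (hq : 0 < q) : unborderedDensity q 0 = 1 := by
  rw [unborderedDensity_eq hq]; simp

lemma unborderedDensity_le_one {q : ℕ} (hq : 0 < q) (n : ℕ) : unborderedDensity q n ≤ 1 := by
  rw [unborderedDensity_eq hq, sub_le_self_iff]
  exact sum_nonneg fun l _ => div_nonneg (unborderedDensity_nonneg q l) (by positivity)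

lemma unborderedDensity_odd {q : ℕ} (hq : 0 < q) (m : ℕ) :
    unborderedDensity q (2 * m + 1) = unborderedDensity q (2 * m) := by
  rw [unborderedDensity_eq hq (2 * m + 1), unborderedDensity_eq hq (2 * m),
    show (2 * m + 1) / 2 = 2 * m / 2 by omega]

lemma unborderedDensity_even {q : ℕ} (hq : 0 < q) (m : ℕ) :
    unborderedDensity q (2 * (m + 1)) =
      unborderedDensity q (2 * m) - unborderedDensity q (m + 1) / (q : ℝ) ^ (m + 1) := by
  rw [unborderedDensity_eq hq (2 * (m + 1)), unborderedDensity_eq hq (2 * m),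
    show 2 * (m + 1) / 2 = m + 1 by omega, show 2 * m / 2 = m by omega,
    sum_Icc_succ_top (by omega)]
  ring

end Counting

section GeneratingFunction

open Finset Filter Topology

/-- The generating function of the unbordered densities, without its constant term. -/
noncomputable def unborderedGF (q : ℕ) (y : ℝ) : ℝ :=
  ∑' n, unborderedDensity q (n + 1) * y ^ (n + 1)

lemma summable_unborderedDensity {q : ℕ} (hq : 0 < q) {y : ℝ} (h0 : 0 ≤ y) (h1 : y < 1) :
    Summable fun n => unborderedDensity q n * y ^ n :=
  Summable.of_nonneg_of_le
    (fun n => mul_nonneg (unborderedDensity_nonneg q n) (pow_nonneg h0 n))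
    (fun n => mul_le_of_le_one_left (pow_nonneg h0 n) (unborderedDensity_le_one hq n))
    (summable_geometric_of_lt_one h0 h1)

lemma tsum_unborderedDensity {q : ℕ} (hq : 0 < q) {y : ℝ} (h0 : 0 ≤ y) (h1 : y < 1) :
    ∑' n, unborderedDensity q n * y ^ n = 1 + unborderedGF q y := by
  rw [(summable_unborderedDensity hq h0 h1).tsum_eq_zero_add, unborderedDensity_zero hq,
    unborderedGF]
  simp

lemma abs_unborderedGF_le {q : ℕ} (hq : 0 < q) {y : ℝ} (h0 : 0 ≤ y) (h1 : y < 1) :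
    |unborderedGF q y| ≤ y / (1 - y) := by
  have hs := (summable_nat_add_iff 1).2 (summable_unborderedDensity hq h0 h1)
  have hg := (summable_nat_add_iff 1).2 (summable_geometric_of_lt_one h0 h1)
  rw [unborderedGF, abs_of_nonneg (tsum_nonneg fun n =>
    mul_nonneg (unborderedDensity_nonneg q _) (pow_nonneg h0 _))]
  refine (hs.tsum_le_tsum (fun n => mul_le_of_le_one_left (pow_nonneg h0 _)
    (unborderedDensity_le_one hq _)) hg).trans_eq ?_
  simp_rw [pow_succ]
  rw [tsum_mul_right, tsum_geometric_of_lt_one h0 h1]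
  ring

lemma one_sub_mul_unborderedGF {q : ℕ} (hq : 0 < q) {y : ℝ} (h0 : 0 ≤ y) (h1 : y < 1) :
    (1 - y) * unborderedGF q y = y - unborderedGF q (y ^ 2 / q) := by
  have hq1 : (1 : ℝ) ≤ q := by exact_mod_cast hq
  have hz0 : 0 ≤ y ^ 2 / q := by positivity
  have hz1 : y ^ 2 / q < 1 := by
    rw [div_lt_one (by positivity)]
    nlinarith
  have hs := summable_unborderedDensity hq h0 h1
  have he : Summable fun m => unborderedDensity q (2 * m) * y ^ (2 * m) :=
    hs.comp_injective (i := fun m => 2 * m) fun a b h => by simpa using h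
  have ho : Summable fun m => unborderedDensity q (2 * m + 1) * y ^ (2 * m + 1) :=
    hs.comp_injective (i := fun m => 2 * m + 1) fun a b h => by simpa using h
  have hsplit : ∑' m, unborderedDensity q (2 * m) * y ^ (2 * m) +
      ∑' m, unborderedDensity q (2 * m + 1) * y ^ (2 * m + 1) =
      ∑' n, unborderedDensity q n * y ^ n :=
    tsum_even_add_odd (f := fun n => unborderedDensity q n * y ^ n) he ho
  rw [tsum_unborderedDensity hq h0 h1] at hsplit
  have hodd : ∑' m, unborderedDensity q (2 * m + 1) * y ^ (2 * m + 1) =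
      y * ∑' m, unborderedDensity q (2 * m) * y ^ (2 * m) := by
    rw [← tsum_mul_left]
    refine tsum_congr fun m => ?_
    rw [unborderedDensity_odd hq]
    ring
  have heven : ∑' m, unborderedDensity q (2 * m) * y ^ (2 * m) =
      1 + (y ^ 2 * (∑' m, unborderedDensity q (2 * m) * y ^ (2 * m)) -
        unborderedGF q (y ^ 2 / q)) := by
    conv_lhs => rw [he.tsum_eq_zero_add]
    rw [unborderedGF, ← tsum_mul_left, ← Summable.tsum_sub (he.mul_left _)
      ((summable_nat_add_iff 1).2 (summable_unborderedDensity hq hz0 hz1))]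
    congr 1
    · simp [unborderedDensity_zero hq]
    · refine tsum_congr fun m => ?_
      rw [unborderedDensity_even hq, div_pow, ← pow_mul]
      ring
  rw [hodd] at hsplit
  linear_combination (-(1 - y)) * hsplit + heven

end GeneratingFunction

section Series

open Finset Filter Topology

/-- The evaluation points `q ^ (1 - 2 ^ (k + 1))`. -/
noncomputable def evalPoint (q k : ℕ) : ℝ := (q : ℝ) ^ ((1 : ℤ) - 2 ^ (k + 1))

lemma evalPoint_zero (q : ℕ) : evalPoint q 0 = (q : ℝ)⁻¹ := by
  norm_num [evalPoint]

lemma evalPoint_succ {q : ℕ} (hq : 0 < q) (k : ℕ) :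
    evalPoint q (k + 1) = evalPoint q k ^ 2 / q := by
  have hq' : (q : ℝ) ≠ 0 := by positivity
  rw [evalPoint, evalPoint, ← zpow_natCast, ← zpow_mul, div_eq_mul_inv,
    ← zpow_sub_one₀ hq']
  congr 1
  push_cast
  ring

lemma evalPoint_pos {q : ℕ} (hq : 0 < q) (k : ℕ) : 0 < evalPoint q k := by
  unfold evalPoint
  positivity

lemma evalPoint_le_half {q : ℕ} (hq : 2 ≤ q) (k : ℕ) : evalPoint q k ≤ 1 / 2 := by
  have hq2 : (2 : ℝ) ≤ q := by exact_mod_cast hq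
  induction k with
  | zero =>
    rw [evalPoint_zero, inv_eq_one_div]
    gcongr
  | succ k ih =>
    have := evalPoint_pos (q := q) (by omega) k
    rw [evalPoint_succ (by omega), div_le_iff₀ (by linarith)]
    nlinarith

lemma Fterm_eq (q i : ℕ) :
    Fterm q i = (-1) ^ i * evalPoint q i / ∏ k ∈ range (i + 1), (1 - evalPoint q k) := rfl

lemma prod_one_sub_evalPoint_pos {q : ℕ} (hq : 2 ≤ q) (n : ℕ) :
    0 < ∏ k ∈ range n, (1 - evalPoint q k) :=
  prod_pos fun k _ => by linarith [evalPoint_le_half hq k]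

lemma abs_Fterm {q : ℕ} (hq : 2 ≤ q) (i : ℕ) :
    |Fterm q i| = evalPoint q i / ∏ k ∈ range (i + 1), (1 - evalPoint q k) := by
  rw [Fterm_eq, abs_div, abs_mul, abs_pow, abs_neg, abs_one, one_pow, one_mul,
    abs_of_pos (evalPoint_pos (by omega) i), abs_of_pos (prod_one_sub_evalPoint_pos hq _)]

lemma abs_Fterm_le {q : ℕ} (hq : 2 ≤ q) (i : ℕ) : |Fterm q i| ≤ (1 / 2) ^ i := by
  have hq2 : (2 : ℝ) ≤ q := by exact_mod_cast hq
  induction i with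
  | zero =>
    have := evalPoint_le_half hq 0
    rw [abs_Fterm hq, pow_zero, div_le_one (prod_one_sub_evalPoint_pos hq _)]
    simp
    linarith
  | succ i ih =>
    have hP := prod_one_sub_evalPoint_pos hq (i + 1)
    have hy := evalPoint_pos (q := q) (by omega) i
    have hy2 := evalPoint_le_half hq i
    have hz2 := evalPoint_le_half hq (i + 1)
    have hratio : evalPoint q (i + 1) ≤ 1 / 2 * evalPoint q i * (1 - evalPoint q (i + 1)) := by
      have : evalPoint q (i + 1) ≤ 1 / 4 * evalPoint q i := by
        rw [evalPoint_succ (by omega), div_le_iff₀ (by linarith)]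
        nlinarith
      nlinarith
    rw [abs_Fterm hq] at ih ⊢
    rw [prod_range_succ, pow_succ', ← div_div, div_le_iff₀ (by linarith), div_le_iff₀ hP]
    rw [div_le_iff₀ hP] at ih
    have hz : 0 < 1 - evalPoint q (i + 1) := by linarith
    calc _ ≤ _ := hratio
      _ ≤ 1 / 2 * ((1 / 2) ^ i * ∏ k ∈ range (i + 1), (1 - evalPoint q k)) *
          (1 - evalPoint q (i + 1)) := by gcongr
      _ = _ := by ring

lemma summable_Fterm {q : ℕ} (hq : 2 ≤ q) : Summable (Fterm q) :=
  Summable.of_norm_bounded (summable_geometric_of_lt_one (by norm_num) (by norm_num))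
    (abs_Fterm_le hq)

lemma unborderedGF_eq_sum_add {q : ℕ} (hq : 2 ≤ q) (n : ℕ) :
    unborderedGF q (evalPoint q 0) = ∑ i ∈ range n, Fterm q i +
      (-1) ^ n * unborderedGF q (evalPoint q n) / ∏ k ∈ range n, (1 - evalPoint q k) := by
  induction n with
  | zero => simp
  | succ n ih =>
    have hP := (prod_one_sub_evalPoint_pos hq n).ne'
    have hy2 := evalPoint_le_half hq n
    have hy : 1 - evalPoint q n ≠ 0 := by linarith
    have h := one_sub_mul_unborderedGF (q := q) (by omega)
      (evalPoint_pos (q := q) (by omega) n).le (by linarith)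
    rw [← evalPoint_succ (by omega)] at h
    have h' : unborderedGF q (evalPoint q (n + 1)) =
      evalPoint q n - (1 - evalPoint q n) * unborderedGF q (evalPoint q n) := by linarith
    rw [ih, sum_range_succ, Fterm_eq, h', prod_range_succ]
    field_simp
    ring

lemma hasSum_Fterm {q : ℕ} (hq : 2 ≤ q) :
    HasSum (Fterm q) (unborderedGF q (evalPoint q 0)) := by
  rw [(summable_Fterm hq).hasSum_iff_tendsto_nat, tendsto_iff_norm_sub_tendsto_zero]
  refine squeeze_zero (fun _ => norm_nonneg _) (fun n => ?_)
    (tendsto_pow_atTop_nhds_zero_of_lt_one (r := (1 / 2 : ℝ)) (by norm_num) (by norm_num))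
  have hP := prod_one_sub_evalPoint_pos hq n
  have hy2 := evalPoint_le_half hq n
  refine le_trans ?_ (abs_Fterm_le hq n)
  rw [unborderedGF_eq_sum_add hq n, sub_add_cancel_left, norm_neg, Real.norm_eq_abs, abs_div,
    abs_mul, abs_pow, abs_neg, abs_one, one_pow, one_mul, abs_of_pos hP, abs_Fterm hq,
    prod_range_succ, mul_comm (∏ k ∈ range n, _), ← div_div]
  gcongr
  exact abs_unborderedGF_le (by omega) (evalPoint_pos (by omega) n).le (by linarith)

lemma tendsto_instProb2_unborderedGF {q : ℕ} (hq : 2 ≤ q) :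
    Tendsto (instProb2 q) atTop (𝓝 (unborderedGF q (evalPoint q 0))) := by
  have hs := (summable_nat_add_iff 1).2 (summable_unborderedDensity (q := q)
    (y := evalPoint q 0) (by omega) (evalPoint_pos (by omega) 0).le
    (by linarith [evalPoint_le_half hq 0]))
  have ht : Tendsto (fun n : ℕ => (n - 1) / 2) atTop atTop :=
    tendsto_atTop.2 fun b => eventually_atTop.2 ⟨2 * b + 1, fun n hn => by omega⟩
  refine (hs.hasSum.tendsto_sum_nat.comp ht).congr fun n => ?_
  rw [instProb2_eq (by omega), Function.comp_apply, range_eq_Ico,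
    sum_Ico_add' (fun l => unborderedDensity q l * evalPoint q 0 ^ l)]
  refine sum_congr rfl fun l _ => ?_
  rw [evalPoint_zero, inv_pow, div_eq_mul_inv]

end Series

/-- For `q ≥ 2`, the asymptotic probability that a word is a `Z₂`-instance exists
and equals `∑_{j≥0} (−1)^j q^{1−2^{j+1}} / ∏_{k=0}^{j} (1 − q^{1−2^{k+1}})`. -/
theorem instProb2_tendsto (q : ℕ) (hq : 2 ≤ q) :
    Summable (Fterm q) ∧
    Filter.Tendsto (fun n => instProb2 q n) Filter.atTop (nhds (∑' i, Fterm q i)) := by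
  exact ⟨summable_Fterm hq, (hasSum_Fterm hq).tsum_eq ▸ tendsto_instProb2_unborderedGF hq⟩
end

section
/- Let L be a nonempty bifix-free word and let W = LAL for some nonempty word A. If W has a Z_2-bifix, then exactly one of the following five mutually exclusive cases holds: (i) W = LBLCLBL for some nonempty words B and C such that LBL is a shortest Z_2-bifix of W; (ii) W = LBLLBL for some nonempty word B such that LBL is a shortest Z_2-bifix of W; (iii) W = LBLBL for some nonempty word B such that LBL is a shortest Z_2-bifix of W; (iv) W = LLFLLFLL for some nonempty word F such that LLFLL is a shortest Z_2-bifix of W; (v) W = LLLL. -/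
/-- `V` is a shortest `Z₂`-bifix of `W`: it is a bifix of `W` that is a
`Z₂`-instance, of minimal length among such. -/
def IsShortestZ2Bifix {α : Type*} (V W : List α) : Prop :=
  IsBifix V W ∧ Z2Instance V ∧
    ∀ U : List α, IsBifix U W → Z2Instance U → V.length ≤ U.length

section
variable {α : Type*} (L W : List α)

/-- Case (i): `W = LBLCLBL` with `LBL` a shortest `Z₂`-bifix of `W` and `C` nonempty. -/
def Case1 : Prop :=
  ∃ B C : List α, B ≠ [] ∧ C ≠ [] ∧
    W = L ++ B ++ L ++ C ++ L ++ B ++ L ∧ IsShortestZ2Bifix (L ++ B ++ L) W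

/-- Case (ii): `W = LBLLBL` with `LBL` a shortest `Z₂`-bifix of `W`. -/
def Case2 : Prop :=
  ∃ B : List α, B ≠ [] ∧
    W = L ++ B ++ L ++ L ++ B ++ L ∧ IsShortestZ2Bifix (L ++ B ++ L) W

/-- Case (iii): `W = LBLBL` with `LBL` a shortest `Z₂`-bifix of `W`. -/
def Case3 : Prop :=
  ∃ B : List α, B ≠ [] ∧
    W = L ++ B ++ L ++ B ++ L ∧ IsShortestZ2Bifix (L ++ B ++ L) W

/-- Case (iv): `W = LLFLLFLL` with `LLFLL` a shortest `Z₂`-bifix of `W`. -/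
def Case4 : Prop :=
  ∃ F : List α, F ≠ [] ∧
    W = L ++ L ++ F ++ L ++ L ++ F ++ L ++ L ∧
    IsShortestZ2Bifix (L ++ L ++ F ++ L ++ L) W

/-- Case (v): `W = LLLL`. -/
def Case5 : Prop := W = L ++ L ++ L ++ L

end

/-- An occurrence of a bifix-free word `L` in a word starting with `L` does not overlap the
initial occurrence properly. -/
theorem BifixFree.eq_nil_or_eq_append {α : Type*} {L S T S' : List α} (hbf : BifixFree L)
    (h : L ++ S = T ++ (L ++ S')) : T = [] ∨ ∃ R, T = L ++ R := by
  rcases List.append_eq_append_iff.1 h with ⟨R, hR, -⟩ | ⟨M, hM, hM'⟩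
  · exact Or.inr ⟨R, hR⟩
  · by_cases hT : T = []
    · exact Or.inl hT
    by_cases hM0 : M = []
    · exact Or.inr ⟨[], by simpa [hM0] using hM.symm⟩
    rcases List.append_eq_append_iff.1 hM' with ⟨R, hR, -⟩ | ⟨N, hN, -⟩
    · have h1 := congrArg List.length hM
      have h2 := congrArg List.length hR
      have h3 := List.length_pos_iff.2 hT
      simp only [List.length_append] at h1 h2
      omega
    · refine absurd ⟨hM0, ⟨N, ?_, hN⟩, ⟨T, hT, hM⟩⟩ (hbf M)
      rintro rfl
      have h1 := congrArg List.length hM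
      have h2 := congrArg List.length hN
      have h3 := List.length_pos_iff.2 hT
      simp only [List.length_append, List.length_nil] at h1 h2
      omega

/-- A bifix of a word `LAL` with `L` bifix-free is `L`, `LL` or of the form `LBL`. -/
theorem IsBifix.eq_or_eq_append {α : Type*} {L A U : List α} (hbf : BifixFree L)
    (hU : IsBifix U (L ++ A ++ L)) :
    U = L ∨ U = L ++ L ∨ ∃ B, B ≠ [] ∧ U = L ++ B ++ L := by
  obtain ⟨hU0, ⟨X, -, hX⟩, ⟨Y, -, hY⟩⟩ := hU
  have hpre : L <+: L ++ A ++ L := by simp [List.append_assoc]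
  have hsuf : L <:+ L ++ A ++ L := List.suffix_append _ _
  have hUpre : U <+: L ++ A ++ L := ⟨X, hX.symm⟩
  have hUsuf : U <:+ L ++ A ++ L := ⟨Y, hY.symm⟩
  rcases Nat.lt_or_ge U.length L.length with hlt | hge
  · obtain ⟨P, hP⟩ := List.prefix_of_prefix_length_le hUpre hpre hlt.le
    obtain ⟨Q, hQ⟩ := List.suffix_of_suffix_length_le hUsuf hsuf hlt.le
    refine absurd ⟨hU0, ⟨P, ?_, hP.symm⟩, ⟨Q, ?_, hQ.symm⟩⟩ (hbf U)
    · rintro rfl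
      simp [← hP] at hlt
    · rintro rfl
      simp [← hQ] at hlt
  · obtain ⟨S, rfl⟩ := List.prefix_of_prefix_length_le hpre hUpre hge
    obtain ⟨T, hT⟩ := List.suffix_of_suffix_length_le hsuf hUsuf hge
    rcases hbf.eq_nil_or_eq_append (S := S) (T := T) (S' := []) (by simpa using hT.symm) with
      rfl | ⟨R, rfl⟩
    · left
      simpa using hT.symm
    · right
      by_cases hR : R = []
      · left
        simpa [hR] using hT.symm
      · exact Or.inr ⟨R, hR, hT.symm⟩

/-- Any `Z₂`-bifix of `LAL` with `L` bifix-free has the form `LBL`. -/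
theorem IsBifix.exists_of_z2Instance {α : Type*} {L A V : List α} (hL : L ≠ [])
    (hbf : BifixFree L) (hV : IsBifix V (L ++ A ++ L)) (hz : Z2Instance V) :
    ∃ B, B ≠ [] ∧ V = L ++ B ++ L := by
  obtain ⟨P, Q, hP, hQ, rfl⟩ := hz
  obtain ⟨-, ⟨X, -, hX⟩, ⟨Y, -, hY⟩⟩ := id hV
  have hPb : IsBifix P (L ++ A ++ L) :=
    ⟨hP, ⟨Q ++ P ++ X, by simp [hP], by simp [hX]⟩, ⟨Y ++ P ++ Q, by simp [hP], by simp [hY]⟩⟩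
  have hPL : L.length ≤ P.length := by
    rcases hPb.eq_or_eq_append hbf with h | h | ⟨B, -, h⟩ <;> simp [h]
  have hQ0 := List.length_pos_iff.2 hQ
  have hL0 := List.length_pos_iff.2 hL
  rcases hV.eq_or_eq_append hbf with h | h | h
  · have := congrArg List.length h
    simp only [List.length_append] at this
    omega
  · have := congrArg List.length h
    simp only [List.length_append] at this
    omega
  · exact h

/-- A word with a `Z₂`-bifix has a shortest one. -/
theorem exists_isShortestZ2Bifix {α : Type*} {W : List α}
    (h : ∃ V, IsBifix V W ∧ Z2Instance V) : ∃ V, IsShortestZ2Bifix V W := by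
  obtain ⟨V, ⟨hV, hz⟩, hmin⟩ :=
    (measure (List.length (α := α))).wf.has_min {V | IsBifix V W ∧ Z2Instance V} h
  exact ⟨V, hV, hz, fun U hU hUz => not_lt.1 (hmin U ⟨hU, hUz⟩)⟩

/-- Two shortest `Z₂`-bifixes of a word have the same length. -/
theorem IsShortestZ2Bifix.length_eq {α : Type*} {U V W : List α}
    (hU : IsShortestZ2Bifix U W) (hV : IsShortestZ2Bifix V W) : U.length = V.length :=
  le_antisymm (hU.2.2 V hV.1 hV.2.1) (hV.2.2 U hU.1 hU.2.1)

/-- A shortest `Z₂`-bifix of `LLLL` is at most as long as `LLL`. -/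
theorem IsShortestZ2Bifix.length_le_three_mul {α : Type*} {L V : List α} (hL : L ≠ [])
    (hV : IsShortestZ2Bifix V (L ++ L ++ L ++ L)) : V.length ≤ 3 * L.length := by
  have := hV.2.2 (L ++ L ++ L) ⟨by simp [hL], ⟨L, hL, rfl⟩, ⟨L, hL, by simp⟩⟩
    ⟨L, L, hL, hL, rfl⟩
  simp only [List.length_append] at this
  omega

/-- At least one of the five cases holds. -/
theorem exists_case {α : Type*} (L A W : List α) (hL : L ≠ []) (hbf : BifixFree L)
    (hW : W = L ++ A ++ L) (hbifix : ∃ V, IsBifix V W ∧ Z2Instance V) :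
    Case1 L W ∨ Case2 L W ∨ Case3 L W ∨ Case4 L W ∨ Case5 L W := by
  obtain ⟨V, hV⟩ := exists_isShortestZ2Bifix hbifix
  obtain ⟨⟨hV0, ⟨X, hX0, hX⟩, ⟨Y, hY0, hY⟩⟩, hz, hmin⟩ := id hV
  obtain ⟨B, hB, hVB⟩ := (hW ▸ hV.1).exists_of_z2Instance hL hbf hz
  have hcase2 : W = V ++ V → Case2 L W := fun h =>
    ⟨B, hB, by rw [h, hVB]; simp, hVB ▸ hV⟩
  rcases List.append_eq_append_iff.1 (hX.symm.trans hY) with ⟨C, hYC, hXC⟩ | ⟨C, hVY, hVX⟩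
  · by_cases hC : C = []
    · exact Or.inr (Or.inl (hcase2 (by simp [hX, hXC, hC])))
    · exact Or.inl ⟨B, C, hB, hC, by rw [hX, hXC, hVB]; simp, hVB ▸ hV⟩
  · by_cases hC : C = []
    · exact Or.inr (Or.inl (hcase2 (by
        rw [hX]; congr 1; simpa [hC] using hVX.symm)))
    have hCb : IsBifix C W :=
      ⟨hC, ⟨X ++ X, by simp [hX0], by rw [hX, hVX]; simp⟩,
        ⟨Y ++ Y, by simp [hY0], by rw [hY, hVY]; simp⟩⟩
    rcases (hW ▸ hCb).eq_or_eq_append hbf with rfl | rfl | ⟨R, hR, rfl⟩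
    · right; right; left
      have hXB : X = B ++ C := by
        have := hVX.symm.trans hVB
        simpa using this
      exact ⟨B, hB, by rw [hX, hVB, hXB]; simp, hVB ▸ hV⟩
    · right; right; right
      have h1 : L ++ (L ++ X) = Y ++ (L ++ L) := by
        rw [← hVY, hVX]; simp
      rcases hbf.eq_nil_or_eq_append h1 with h | ⟨R, rfl⟩
      · exact absurd h hY0
      have h2 : L ++ X = R ++ (L ++ L) := by simpa using h1
      rcases hbf.eq_nil_or_eq_append h2 with rfl | ⟨F, rfl⟩
      · right
        have h3 : V = L ++ L ++ L := by simpa using hVY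
        show W = _
        rw [hY, h3]; simp
      · left
        have h3 : V = L ++ L ++ F ++ L ++ L := by rw [hVY]; simp
        refine ⟨F, ?_, by rw [hY, h3]; simp, h3 ▸ hV⟩
        rintro rfl
        have h4 := hmin (L ++ L ++ L)
          ⟨by simp [hL], ⟨L ++ L ++ L, by simp [hL], by rw [hY, h3]; simp⟩,
            ⟨L ++ L ++ L, by simp [hL], by rw [hY, h3]; simp⟩⟩ ⟨L, L, hL, hL, rfl⟩
        have h5 := List.length_pos_iff.2 hL
        simp only [h3, List.length_append, List.length_nil] at h4
        omega
    · have h4 := hmin _ hCb ⟨L, R, hL, hR, rfl⟩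
      have h5 := congrArg List.length hVY
      have h6 := List.length_pos_iff.2 hY0
      simp only [List.length_append] at h4 h5
      omega

/-- If `L` is a nonempty bifix-free word and `W = LAL` (with `A` nonempty) has a
`Z₂`-bifix, then exactly one of the five mutually exclusive cases holds. -/
theorem five_cases {α : Type*} (L A W : List α) (hL : L ≠ []) (hbf : BifixFree L)
    (hA : A ≠ []) (hW : W = L ++ A ++ L)
    (hbifix : ∃ V, IsBifix V W ∧ Z2Instance V) :
    (Case1 L W ∨ Case2 L W ∨ Case3 L W ∨ Case4 L W ∨ Case5 L W) ∧
    ¬(Case1 L W ∧ Case2 L W) ∧ ¬(Case1 L W ∧ Case3 L W) ∧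
    ¬(Case1 L W ∧ Case4 L W) ∧ ¬(Case1 L W ∧ Case5 L W) ∧
    ¬(Case2 L W ∧ Case3 L W) ∧ ¬(Case2 L W ∧ Case4 L W) ∧
    ¬(Case2 L W ∧ Case5 L W) ∧ ¬(Case3 L W ∧ Case4 L W) ∧
    ¬(Case3 L W ∧ Case5 L W) ∧ ¬(Case4 L W ∧ Case5 L W) := by
  have hl := List.length_pos_iff.2 hL
  refine ⟨exists_case L A W hL hbf hW hbifix, ?_, ?_, ?_, ?_, ?_, ?_, ?_, ?_, ?_, ?_⟩
  · rintro ⟨⟨B₁, C₁, hB₁, hC₁, hW₁, hV₁⟩, ⟨B₂, hB₂, hW₂, hV₂⟩⟩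
    have hw := congrArg List.length (hW₁.symm.trans hW₂)
    have hv := hV₁.length_eq hV₂
    have hc := List.length_pos_iff.2 hC₁
    simp only [List.length_append] at hw hv
    omega
  · rintro ⟨⟨B₁, C₁, hB₁, hC₁, hW₁, hV₁⟩, ⟨B₂, hB₂, hW₂, hV₂⟩⟩
    have hw := congrArg List.length (hW₁.symm.trans hW₂)
    have hv := hV₁.length_eq hV₂
    have hc := List.length_pos_iff.2 hC₁
    simp only [List.length_append] at hw hv
    omega
  · rintro ⟨⟨B₁, C₁, hB₁, hC₁, hW₁, hV₁⟩, ⟨B₂, hB₂, hW₂, hV₂⟩⟩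
    have hw := congrArg List.length (hW₁.symm.trans hW₂)
    have hv := hV₁.length_eq hV₂
    have hc := List.length_pos_iff.2 hC₁
    simp only [List.length_append] at hw hv
    omega
  · rintro ⟨⟨B₁, C₁, hB₁, hC₁, hW₁, hV₁⟩, hW₂⟩
    have hw := congrArg List.length (hW₁.symm.trans hW₂)
    have hv := (hW₂ ▸ hV₁).length_le_three_mul hL
    have hb := List.length_pos_iff.2 hB₁
    simp only [List.length_append] at hw hv hb
    omega
  · rintro ⟨⟨B₁, hB₁, hW₁, hV₁⟩, ⟨B₂, hB₂, hW₂, hV₂⟩⟩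
    have hw := congrArg List.length (hW₁.symm.trans hW₂)
    have hv := hV₁.length_eq hV₂
    simp only [List.length_append] at hw hv
    omega
  · rintro ⟨⟨B₁, hB₁, hW₁, hV₁⟩, ⟨B₂, hB₂, hW₂, hV₂⟩⟩
    have hw := congrArg List.length (hW₁.symm.trans hW₂)
    have hv := hV₁.length_eq hV₂
    simp only [List.length_append] at hw hv
    omega
  · rintro ⟨⟨B₁, hB₁, hW₁, hV₁⟩, hW₂⟩
    have hw := congrArg List.length (hW₁.symm.trans hW₂)
    have hv := (hW₂ ▸ hV₁).length_le_three_mul hL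
    have hb := List.length_pos_iff.2 hB₁
    simp only [List.length_append] at hw hv hb
    omega
  · rintro ⟨⟨B₁, hB₁, hW₁, hV₁⟩, ⟨B₂, hB₂, hW₂, hV₂⟩⟩
    have hw := congrArg List.length (hW₁.symm.trans hW₂)
    have hv := hV₁.length_eq hV₂
    simp only [List.length_append] at hw hv
    omega
  · rintro ⟨⟨B₁, hB₁, hW₁, hV₁⟩, hW₂⟩
    have hw := congrArg List.length (hW₁.symm.trans hW₂)
    have hv := (hW₂ ▸ hV₁).length_le_three_mul hL
    have hb := List.length_pos_iff.2 hB₁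
    have h : L ++ (L ++ L) = B₁ ++ (L ++ (B₁ ++ L)) := by
      have := hW₂.symm.trans hW₁
      simpa using this
    rcases hbf.eq_nil_or_eq_append h with h | ⟨R, rfl⟩
    · exact hB₁ h
    simp only [List.length_append] at hw hv hb
    omega
  · rintro ⟨⟨B₁, hB₁, hW₁, hV₁⟩, hW₂⟩
    have hw := congrArg List.length (hW₁.symm.trans hW₂)
    have hv := (hW₂ ▸ hV₁).length_le_three_mul hL
    have hb := List.length_pos_iff.2 hB₁
    simp only [List.length_append] at hw hv hb
    omega
end

section
/- Let q ≥ 1 be an integer and let L be a bifix-free word over [q] of odd length ℓ > 1. Then the counting sequences c_n = c_n^ℓ and d_n = d_n^ℓ satisfy: c_n = 0 for 1 ≤ n ≤ 2ℓ; c_{2ℓ+1} = q; c_{4ℓ} = q·(c_{4ℓ−1} + c_{⌊5ℓ/2⌋}) − (c_{2ℓ} + 1); c_{5ℓ} = q·c_{5ℓ−1} − (c_{3ℓ} − 1); c_{5ℓ+1} = q·(c_{5ℓ} + c_{3ℓ} − 1) − c_{⌈5ℓ/2⌉}; c_{6ℓ} = q·(c_{6ℓ−1} + c_{⌊7ℓ/2⌋})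 − (c_{3ℓ} − 1); c_{2k} = q·(c_{2k−1} + c_{k+⌊ℓ/2⌋}) − c_k for every k > ℓ with k ∉ {2ℓ, ⌈5ℓ/2⌉, 3ℓ}; c_{2k+1} = q·c_{2k} − c_{k+⌈ℓ/2⌉} for every k > ℓ with k ≠ ⌊5ℓ/2⌋; d_n = 0 for 1 ≤ n ≤ 4ℓ; d_{4ℓ+1} = q; d_{5ℓ} = q·d_{5ℓ−1} − 1; d_{5ℓ+1} = q·(d_{5ℓ} + 1); d_{6ℓ} = q·d_{6ℓ−1} − 1; d_{2k} = q·(d_{2k−1} + d_{k+⌊ℓ/2⌋}) − (d_k + d_{k+ℓ}) for every k > 2ℓ with k ∉ {⌈5ℓ/2⌉, 3ℓ}; and d_{2k+1} = q·(d_{2k} + d_{k+ℓ}) − d_{k+⌈ℓ/2⌉} for every k > 2ℓ with k ≠ ⌊5ℓ/2⌋. -/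
/-- A word is `Z₂`-bifix-free if it has no bifix that is a `Z₂`-instance. -/
def Z2BifixFree {α : Type*} (W : List α) : Prop :=
  ∀ V, ¬ (IsBifix V W ∧ Z2Instance V)

/-- For a fixed word `L`, `dCount q L n` counts the `Z₂`-bifix-free words `W` of
length `n` over `[q]` with `W = LAL` for some nonempty `A` that moreover have the
form `W = LLA′LL` for some nonempty `A′`. -/
noncomputable def dCount (q : ℕ) (L : List (Fin q)) (n : ℕ) : ℕ :=
  Nat.card {W : List (Fin q) // W.length = n ∧ (∃ A, A ≠ [] ∧ W = L ++ A ++ L) ∧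
    (∃ A', A' ≠ [] ∧ W = L ++ L ++ A' ++ L ++ L) ∧ Z2BifixFree W}

/-- For a fixed word `L`, `cCount q L n` counts the `Z₂`-bifix-free words `W` of
length `n` over `[q]` with `W = LAL` for some nonempty `A` that are not of the
form `W = LLA′LL` for a nonempty `A′`. -/
noncomputable def cCount (q : ℕ) (L : List (Fin q)) (n : ℕ) : ℕ :=
  Nat.card {W : List (Fin q) // W.length = n ∧ (∃ A, A ≠ [] ∧ W = L ++ A ++ L) ∧
    ¬ (∃ A', A' ≠ [] ∧ W = L ++ L ++ A' ++ L ++ L) ∧ Z2BifixFree W}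

namespace BifixCount

/-- `V` is a prefix and a suffix of `W`, possibly empty or equal to `W`. -/
def Border {α : Type*} (V W : List α) : Prop := V <+: W ∧ V <:+ W

section Words

variable {α : Type*} {U V W X Y L : List α}

theorem Border.trans (h : Border U V) (h' : Border V W) : Border U W :=
  ⟨h.1.trans h'.1, h.2.trans h'.2⟩

theorem Border.of_length_le (h : Border U W) (h' : Border V W) (hl : U.length ≤ V.length) :
    Border U V :=
  ⟨List.prefix_of_prefix_length_le h.1 h'.1 hl, List.suffix_of_suffix_length_le h.2 h'.2 hl⟩

theorem exists_overlap (hX : X <+: W) (hY : Y <:+ W) (h : W.length ≤ X.length + Y.length) :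
    ∃ U, U.length = X.length + Y.length - W.length ∧ U <:+ X ∧ U <+: Y := by
  obtain ⟨A, rfl⟩ := hX
  obtain ⟨B, hB⟩ := hY
  have hl := congrArg List.length hB
  simp only [List.length_append] at hl h
  rcases List.append_eq_append_iff.1 hB with ⟨C, rfl, rfl⟩ | ⟨C, rfl, rfl⟩
  · refine ⟨C, ?_, List.suffix_append _ _, List.prefix_append _ _⟩
    simp only [List.length_append] at *
    omega
  · refine ⟨[], ?_, List.nil_suffix, List.nil_prefix⟩
    simp only [List.length_append, List.length_nil] at *
    omega

theorem exists_middle (hX : X <+: W) (hY : Y <:+ W) (h : X.length + Y.length ≤ W.length) :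
    ∃ A, W = X ++ A ++ Y := by
  obtain ⟨A, rfl⟩ := hX
  rw [List.length_append] at h
  obtain ⟨B, rfl⟩ := List.suffix_of_suffix_length_le hY (List.suffix_append X A) (by omega)
  exact ⟨B, by simp⟩

theorem prefix_append_suffix_iff : (∃ A, A ≠ [] ∧ W = X ++ A ++ Y) ↔
    X <+: W ∧ Y <:+ W ∧ X.length + Y.length < W.length := by
  constructor
  · rintro ⟨A, hA, rfl⟩
    have := List.length_pos_iff.2 hA
    refine ⟨by simp [List.append_assoc], List.suffix_append _ _, ?_⟩
    simp only [List.length_append]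
    omega
  · rintro ⟨hX, hY, h⟩
    obtain ⟨A, rfl⟩ := exists_middle hX hY h.le
    refine ⟨A, ?_, rfl⟩
    rintro rfl
    simp at h

theorem isBifix_iff : IsBifix V W ↔ V ≠ [] ∧ Border V W ∧ V.length < W.length := by
  constructor
  · rintro ⟨hV, ⟨A, hA, rfl⟩, B, -, h⟩
    have := List.length_pos_iff.2 hA
    exact ⟨hV, ⟨List.prefix_append _ _, h ▸ List.suffix_append _ _⟩, by simp; omega⟩
  · rintro ⟨hV, ⟨⟨A, rfl⟩, B, hB⟩, h⟩
    refine ⟨hV, ⟨A, ?_, rfl⟩, B, ?_, hB.symm⟩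
    · rintro rfl
      simp at h
    · rintro rfl
      rw [← hB] at h
      simp at h

theorem Border.length_eq_of_bifixFree (hL : BifixFree L) (h : Border U L) (hU : 0 < U.length) :
    U.length = L.length := by
  by_contra hne
  exact hL U (isBifix_iff.2 ⟨List.length_pos_iff.1 hU, h, lt_of_le_of_ne h.1.length_le hne⟩)

/-- Occurrences of a bifix-free word overlap only if they coincide. -/
theorem length_eq_of_overlap (hL : BifixFree L) (h : L <+: W) (h' : L <:+ W)
    (hl : W.length < 2 * L.length) : W.length = L.length := by
  obtain ⟨U, hU, h1, h2⟩ := exists_overlap h h' (by omega)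
  have := Border.length_eq_of_bifixFree hL ⟨h2, h1⟩ (by omega)
  omega

theorem Border.length_cases (hL : BifixFree L) (h : Border L W) (hV : Border V W)
    (hpos : 0 < V.length) : V.length = L.length ∨ 2 * L.length ≤ V.length := by
  by_cases hlt : V.length < L.length
  · have := Border.length_eq_of_bifixFree hL (hV.of_length_le h hlt.le) hpos
    omega
  · have hLV := h.of_length_le hV (by omega)
    by_cases h2 : V.length < 2 * L.length
    · exact Or.inl (length_eq_of_overlap hL hLV.1 hLV.2 h2)
    · omega

theorem Border.eq_append_self (h : Border L V) (hl : V.length = 2 * L.length) : V = L ++ L := by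
  obtain ⟨A, rfl⟩ := exists_middle h.1 h.2 (by omega)
  simp only [List.length_append] at hl
  have : A = [] := List.length_eq_zero_iff.1 (by omega)
  simp [this]

theorem Border.z2Instance_iff (hL : BifixFree L) (hpos : 0 < L.length) (h : Border L V) :
    Z2Instance V ↔ 2 * L.length < V.length := by
  constructor
  · rintro ⟨A, B, hA, hB, rfl⟩
    have hb : Border A (A ++ B ++ A) := ⟨by simp [List.append_assoc], List.suffix_append _ _⟩
    have hA' := List.length_pos_iff.2 hA
    have hB' := List.length_pos_iff.2 hB
    have := h.length_cases hL hb hA'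
    simp only [List.length_append]
    omega
  · intro hl
    obtain ⟨A, hA, hW⟩ := prefix_append_suffix_iff.2 ⟨h.1, h.2, by omega⟩
    exact ⟨L, A, List.length_pos_iff.1 hpos, hA, hW⟩

theorem Border.z2BifixFree_iff (hL : BifixFree L) (hpos : 0 < L.length) (h : Border L W) :
    Z2BifixFree W ↔ ∀ V, Border V W → V.length < W.length → V.length ≤ 2 * L.length := by
  refine forall_congr' fun V => ?_
  rw [isBifix_iff]
  constructor
  · intro hV hb hl
    by_contra! hgt
    exact hV ⟨⟨List.length_pos_iff.1 (by omega), hb, hl⟩,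
      ((h.of_length_le hb (by omega)).z2Instance_iff hL hpos).2 hgt⟩
  · rintro hV ⟨⟨hne, hb, hl⟩, hz⟩
    have hc := h.length_cases hL hb (List.length_pos_iff.2 hne)
    have := ((h.of_length_le hb (by omega)).z2Instance_iff hL hpos).1 hz
    have := hV hb hl
    omega

/-- `W` begins and ends with `L` and has no proper border longer than `2 * |L|`. -/
def Good (L W : List α) : Prop :=
  Border L W ∧ ∀ V, Border V W → V.length < W.length → V.length ≤ 2 * L.length

theorem exists_good_border (L : List α) (W : List α) (h : Border L W)
    (hl : 2 * L.length < W.length) : ∃ V, Good L V ∧ Border V W ∧ 2 * L.length < V.length := by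
  induction hn : W.length using Nat.strong_induction_on generalizing W with
  | _ n ih =>
    by_cases hg : ∀ V, Border V W → V.length < W.length → V.length ≤ 2 * L.length
    · exact ⟨W, ⟨h, hg⟩, ⟨List.prefix_rfl, List.suffix_rfl⟩, hl⟩
    · push Not at hg
      obtain ⟨V, hV, hlt, hgt⟩ := hg
      obtain ⟨U, hU, hUV, hlU⟩ :=
        ih V.length (by omega) V (h.of_length_le hV (by omega)) hgt rfl
      exact ⟨U, hU, hUV.trans hV, hlU⟩

theorem good_border_length_unique (hU : Good L U) (hV : Good L V) (hUW : Border U W)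
    (hVW : Border V W) (hlU : 2 * L.length < U.length) (hlV : 2 * L.length < V.length) :
    U.length = V.length := by
  rcases lt_trichotomy U.length V.length with h | h | h
  · have := hV.2 U (hUW.of_length_le hVW h.le) h
    omega
  · exact h
  · have := hU.2 V (hVW.of_length_le hUW h.le) h
    omega

theorem eq_append_append_of_border (hL : BifixFree L) (h : Border (L ++ L) W)
    (hl : 2 * L.length < W.length) (hu : W.length < 4 * L.length) :
    W = L ++ L ++ L := by
  obtain ⟨U, hU, h1, h2⟩ := exists_overlap h.1 h.2 (by simp; omega)
  simp only [List.length_append] at hU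
  have hLL : Border L (L ++ L) := ⟨List.prefix_append _ _, List.suffix_append _ _⟩
  have hc := hLL.length_cases hL ⟨h2, h1⟩ (by omega)
  have hw : W.length = 3 * L.length := by omega
  obtain ⟨A, rfl⟩ := exists_middle h.1 (hLL.trans h).2 (by simp; omega)
  have : A = [] := List.length_eq_zero_iff.1 (by simp only [List.length_append] at hw; omega)
  simp [this]

end Words

section Counting

open Finset

variable {q : ℕ} {L : List (Fin q)} {P : List (Fin q) → Prop} {m n : ℕ}

/-- The words of length `n` over `[q]` satisfying `P`. -/
noncomputable def words (n : ℕ) (P : List (Fin q) → Prop) : Finset (List (Fin q)) :=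
  ((List.finite_length_eq (Fin q) n).subset (Set.sep_subset _ P)).toFinset

theorem mem_words {W : List (Fin q)} : W ∈ words n P ↔ W.length = n ∧ P W := by
  simp [words]

theorem card_words_congr {P' : List (Fin q) → Prop}
    (h : ∀ W : List (Fin q), W.length = n → (P W ↔ P' W)) :
    #(words n P) = #(words n P') := by
  congr 1
  ext W
  simp only [mem_words]
  exact and_congr_right (h W)

theorem card_words_add (P P' : List (Fin q) → Prop) :
    #(words n fun W => P W ∧ P' W) + #(words n fun W => P W ∧ ¬ P' W) = #(words n P) := by
  rw [← card_union_of_disjoint]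
  · congr 1
    ext W
    simp only [mem_union, mem_words]
    tauto
  · rw [disjoint_left]
    simp only [mem_words]
    tauto

theorem card_words_true (q n : ℕ) : #(words n fun _ : List (Fin q) => True) = q ^ n := by
  have h := card_vector (α := Fin q) n
  rw [Fintype.card_fin] at h
  rw [← h, ← Nat.card_eq_fintype_card]
  exact (Nat.subtype_card _ fun W => by simp [mem_words]).symm

theorem card_words_prefix_suffix (X Y : List (Fin q)) (h : X.length + Y.length ≤ n) :
    #(words n fun W => X <+: W ∧ Y <:+ W) = q ^ (n - (X.length + Y.length)) := by
  rw [← card_words_true, ← card_image_of_injective (words (n - (X.length + Y.length)) _)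
    (f := fun A => X ++ A ++ Y) (fun A B hAB => by simpa using hAB)]
  congr 1
  ext W
  simp only [mem_words, mem_image, and_true]
  constructor
  · rintro ⟨rfl, hX, hY⟩
    obtain ⟨A, rfl⟩ := exists_middle hX hY h
    exact ⟨A, by simp only [List.length_append]; omega, rfl⟩
  · rintro ⟨A, hA, rfl⟩
    exact ⟨by simp only [List.length_append]; omega, by simp [List.append_assoc],
      List.suffix_append _ _⟩

/-- The words of length `n` having a border of length `m` that satisfies `Q`. -/
noncomputable def bordered (n m : ℕ) (Q : List (Fin q) → Prop) : Finset (List (Fin q)) :=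
  words n fun W => ∃ V, V.length = m ∧ Q V ∧ Border V W

theorem card_bordered_self (n : ℕ) (Q : List (Fin q) → Prop) :
    #(bordered n n Q) = #(words n Q) := by
  refine card_words_congr fun W hW => ⟨?_, fun h => ⟨W, hW, h, List.prefix_rfl, List.suffix_rfl⟩⟩
  rintro ⟨V, hV, hQ, hb⟩
  rwa [← hb.1.eq_of_length (hV.trans hW.symm)]

theorem card_bordered_of_two_mul_le (h : 2 * m ≤ n) (Q : List (Fin q) → Prop) :
    #(bordered n m Q) = q ^ (n - 2 * m) * #(words m Q) := by
  rw [mul_comm, ← card_words_true, ← card_product]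
  symm
  refine card_nbij (fun p => p.1 ++ p.2 ++ p.1) ?_ ?_ ?_
  · rintro ⟨V, A⟩ hVA
    simp only [coe_product, Set.mem_prod, mem_coe, mem_words, and_true, bordered]
      at hVA ⊢
    refine ⟨?_, V, hVA.1.1, hVA.1.2, by simp [List.append_assoc], List.suffix_append _ _⟩
    simp only [List.length_append]
    omega
  · rintro ⟨V, A⟩ hVA ⟨V', A'⟩ hVA' heq
    simp only [coe_product, Set.mem_prod, mem_coe, mem_words, and_true]
      at hVA hVA' heq
    obtain ⟨h1, h2⟩ := List.append_inj heq (by simp only [List.length_append]; omega)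
    obtain ⟨h3, h4⟩ := List.append_inj h1 (by omega)
    rw [h3, h4]
  · intro W hW
    simp only [mem_coe, bordered, mem_words] at hW
    obtain ⟨hW, V, hV, hQ, hb⟩ := hW
    obtain ⟨A, rfl⟩ := exists_middle hb.1 hb.2 (by omega)
    simp only [List.length_append] at hW
    refine ⟨⟨V, A⟩, ?_, rfl⟩
    simp only [coe_product, Set.mem_prod, mem_coe, mem_words, and_true]
    exact ⟨⟨hV, hQ⟩, by omega⟩

theorem card_bordered_of_le_two_mul (h : n ≤ 2 * m) (hmn : m ≤ n) (Q : List (Fin q) → Prop) :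
    #(bordered n m Q) =
      #(words m fun V => Q V ∧ ∃ U, U.length = 2 * m - n ∧ Border U V) := by
  symm
  refine card_nbij (fun V => V ++ V.drop (2 * m - n)) ?_ ?_ ?_
  · intro V hV
    simp only [mem_coe, bordered, mem_words] at hV ⊢
    obtain ⟨hV, hQ, U, hU, ⟨A, rfl⟩, B, hB⟩ := hV
    rw [← hU, List.drop_left]
    simp only [List.length_append] at hV
    refine ⟨by simp only [List.length_append]; omega, _, by simpa using hV, hQ,
      List.prefix_append _ _, B, ?_⟩
    rw [← List.append_assoc, hB]
  · intro V hV V' hV' heq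
    simp only [mem_coe, mem_words] at hV hV' heq
    exact (List.append_inj heq (hV.1.trans hV'.1.symm)).1
  · intro W hW
    simp only [mem_coe, bordered, mem_words] at hW
    obtain ⟨rfl, V, rfl, hQ, hb⟩ := hW
    obtain ⟨U, hU, h1, h2⟩ := exists_overlap hb.1 hb.2 (by omega)
    have hU' : U.length = 2 * V.length - W.length := by omega
    refine ⟨V, ?_, ?_⟩
    · exact mem_coe.2 (mem_words.2 ⟨rfl, hQ, U, hU', h2, h1⟩)
    · obtain ⟨A, rfl⟩ := hb.1
      have hA : A <:+ V :=
        List.suffix_of_suffix_length_le (List.suffix_append _ _) hb.2 (by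
          simp only [List.length_append] at hmn h; omega)
      obtain ⟨B, rfl⟩ := hA
      simp only
      congr 1
      simp only [List.length_append] at hU' h ⊢
      rw [show 2 * (B.length + A.length) - (B.length + A.length + A.length) = B.length by omega,
        List.drop_left]

/-- The number of good words of length `n` satisfying `P`; zero by convention if `n ≤ 2 * |L|`. -/
noncomputable def goodCount (L : List (Fin q)) (P : List (Fin q) → Prop) (n : ℕ) : ℕ :=
  if 2 * L.length < n then #(words n fun W => Good L W ∧ P W) else 0

theorem card_eq_sum_bordered
    (hP : ∀ V W, Border V W → 2 * L.length < V.length → (P V ↔ P W)) (hn : 2 * L.length < n) :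
    #(words n fun W => Border L W ∧ P W) =
      ∑ m ∈ Ioc (2 * L.length) n, #(bordered n m fun V => Good L V ∧ P V) := by
  rw [← card_biUnion]
  · congr 1
    ext W
    simp only [mem_biUnion, bordered, mem_words, mem_Ioc]
    constructor
    · rintro ⟨rfl, hL, hPW⟩
      obtain ⟨V, hV, hb, hl⟩ := exists_good_border L W hL hn
      exact ⟨V.length, ⟨hl, hb.1.length_le⟩, rfl, V, rfl, ⟨hV, (hP V W hb hl).2 hPW⟩, hb⟩
    · rintro ⟨m, hm, rfl, V, rfl, ⟨hV, hPV⟩, hb⟩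
      exact ⟨rfl, hV.1.trans hb, (hP V W hb hm.1).1 hPV⟩
  · intro m hm m' hm' hne
    simp only [coe_Ioc, Set.mem_Ioc] at hm hm'
    rw [Function.onFun, disjoint_left]
    simp only [bordered, mem_words]
    rintro W ⟨-, V, hV, ⟨hgV, -⟩, hb⟩ ⟨-, V', hV', ⟨hgV', -⟩, hb'⟩
    exact hne (by rw [← hV, ← hV', good_border_length_unique hgV hgV' hb hb' (by omega) (by omega)])

theorem card_bordered_good (hL : BifixFree L) (hpos : 0 < L.length) (hm : 2 * L.length < m)
    (hmn : m ≤ n) :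
    #(bordered n m fun V => Good L V ∧ P V) =
      (if 2 * m ≤ n then q ^ (n - 2 * m) * goodCount L P m else 0) +
      (if m = n then goodCount L P n else 0) +
      (if 2 * m = n + L.length then goodCount L P m else 0) +
      (if 2 * m = n + 2 * L.length then
        goodCount L (fun W => P W ∧ Border (L ++ L) W) m else 0) := by
  have hg : ∀ P, goodCount L P m = #(words m fun W => Good L W ∧ P W) := fun P => if_pos hm
  by_cases h1 : 2 * m ≤ n
  · rw [card_bordered_of_two_mul_le h1, if_pos h1, if_neg (by omega), if_neg (by omega),
      if_neg (by omega), hg]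
    simp
  by_cases h2 : m = n
  · subst h2
    rw [card_bordered_self, if_neg h1, if_pos rfl, if_neg (by omega), if_neg (by omega), hg]
    simp
  rw [card_bordered_of_le_two_mul (by omega) hmn, if_neg h1, if_neg h2]
  by_cases h3 : 2 * m = n + L.length
  · rw [if_pos h3, if_neg (by omega), hg, zero_add, zero_add, add_zero]
    refine card_words_congr fun W _ => and_iff_left_of_imp fun h => ⟨L, by omega, h.1.1⟩
  by_cases h4 : 2 * m = n + 2 * L.length
  · rw [if_neg h3, if_pos h4, hg, zero_add, zero_add, zero_add]
    refine card_words_congr fun W _ => ?_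
    rw [and_assoc]
    refine and_congr_right fun hW => and_congr_right fun _ => ⟨?_, fun h => ⟨_, ?_, h⟩⟩
    · rintro ⟨U, hU, hb⟩
      rwa [← (hW.1.of_length_le hb (by omega)).eq_append_self (by omega)]
    · simp only [List.length_append]
      omega
  · rw [if_neg h3, if_neg h4, card_eq_zero, eq_empty_iff_forall_notMem]
    rintro W hW
    obtain ⟨hW, ⟨hG, -⟩, U, hU, hb⟩ := mem_words.1 hW
    have := hG.1.length_cases hL hb (by omega)
    have := hG.2 U hb (by omega)
    omega

theorem card_eq_add_sum (hL : BifixFree L) (hpos : 0 < L.length)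
    (hP : ∀ V W, Border V W → 2 * L.length < V.length → (P V ↔ P W)) (hn : 2 * L.length < n) :
    #(words n fun W => Border L W ∧ P W) =
      ∑ m ∈ Ioc (2 * L.length) (n / 2), q ^ (n - 2 * m) * goodCount L P m +
      goodCount L P n +
      (if Even (n + L.length) then goodCount L P ((n + L.length) / 2) else 0) +
      (if Even n then
        goodCount L (fun W => P W ∧ Border (L ++ L) W) (n / 2 + L.length) else 0) := by
  rw [card_eq_sum_bordered hP hn]
  rw [sum_congr rfl fun m hm => card_bordered_good hL hpos (mem_Ioc.1 hm).1 (mem_Ioc.1 hm).2]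
  rw [sum_add_distrib, sum_add_distrib, sum_add_distrib]
  congr 1
  · congr 1
    · congr 1
      · rw [← sum_filter]
        refine sum_congr ?_ fun _ _ => rfl
        ext m
        simp only [mem_filter, mem_Ioc]
        omega
      · rw [sum_ite_eq' (Ioc _ n) n fun _ => goodCount L P n, if_pos (by simp; omega)]
    · split_ifs with h
      · rw [sum_eq_single ((n + L.length) / 2)]
        · rw [if_pos]
          obtain ⟨r, hr⟩ := h
          omega
        · intro m _ hm
          rw [if_neg (by omega)]
        · intro hm
          simp only [mem_Ioc, not_and_or] at hm
          rw [goodCount]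
          split_ifs <;> first | rfl | omega
      · refine sum_eq_zero fun m _ => if_neg fun hm => h ⟨m, by omega⟩
  · split_ifs with h
    · rw [sum_eq_single (n / 2 + L.length)]
      · rw [if_pos]
        obtain ⟨r, hr⟩ := h
        omega
      · intro m _ hm
        rw [if_neg (by omega)]
      · intro hm
        obtain ⟨r, hr⟩ := h
        simp only [mem_Ioc] at hm
        omega
    · refine sum_eq_zero fun m _ => if_neg fun hm => h ⟨m - L.length, by omega⟩
theorem goodCount_of_le (P : List (Fin q) → Prop) (h : n ≤ 2 * L.length) :
    goodCount L P n = 0 :=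
  if_neg (by omega)

/-- The contribution to `card_eq_add_sum` of the borders that do not overlap. -/
noncomputable def goodSum (L : List (Fin q)) (P : List (Fin q) → Prop) (k : ℕ) : ℕ :=
  ∑ m ∈ Ioc (2 * L.length) k, q ^ (2 * k - 2 * m) * goodCount L P m

theorem goodSum_of_le {k : ℕ} (hk : k ≤ 2 * L.length) : goodSum L P k = 0 := by
  rw [goodSum, Ioc_eq_empty (by omega), sum_empty]

theorem goodSum_succ (k : ℕ) :
    goodSum L P (k + 1) = q ^ 2 * goodSum L P k + goodCount L P (k + 1) := by
  by_cases hk : 2 * L.length ≤ k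
  · rw [goodSum, sum_Ioc_succ_top hk, goodSum, mul_sum]
    congr 1
    · refine sum_congr rfl fun m hm => ?_
      rw [mem_Ioc] at hm
      rw [← mul_assoc, ← pow_add]
      congr 2
      omega
    · simp
  · rw [goodSum_of_le (by omega), goodSum_of_le (by omega), goodCount_of_le P (by omega)]
    simp

theorem card_even (hL : BifixFree L) (hodd : Odd L.length)
    (hP : ∀ V W, Border V W → 2 * L.length < V.length → (P V ↔ P W)) {k : ℕ}
    (hk : L.length < k) :
    #(words (2 * k) fun W => Border L W ∧ P W) = goodSum L P k + goodCount L P (2 * k) +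
      goodCount L (fun W => P W ∧ Border (L ++ L) W) (k + L.length) := by
  have hodd' : ¬ Even (2 * k + L.length) := by
    rw [Nat.even_add]
    simp [hodd]
  rw [card_eq_add_sum hL hodd.pos hP (by omega), if_neg hodd', if_pos (even_two_mul k),
    Nat.mul_div_cancel_left k two_pos, goodSum, add_zero]

theorem card_odd (hL : BifixFree L) (hodd : Odd L.length)
    (hP : ∀ V W, Border V W → 2 * L.length < V.length → (P V ↔ P W)) {k : ℕ}
    (hk : L.length ≤ k) :
    #(words (2 * k + 1) fun W => Border L W ∧ P W) = q * goodSum L P k +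
      goodCount L P (2 * k + 1) + goodCount L P (k + (L.length + 1) / 2) := by
  have heven : Even (2 * k + 1 + L.length) := by
    rw [add_assoc]
    exact (even_two_mul k).add (hodd.one_add)
  rw [card_eq_add_sum hL hodd.pos hP (by omega), if_pos heven, if_neg (by simp),
    goodSum, mul_sum, add_zero, show (2 * k + 1) / 2 = k by omega,
    show (2 * k + 1 + L.length) / 2 = k + (L.length + 1) / 2 by omega]
  congr 2
  refine sum_congr rfl fun m hm => ?_
  rw [mem_Ioc] at hm
  rw [← mul_assoc, ← pow_succ']
  congr 2
  omega

theorem card_even_sub (hL : BifixFree L) (hodd : Odd L.length)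
    (hP : ∀ V W, Border V W → 2 * L.length < V.length → (P V ↔ P W)) {k : ℕ}
    (hk : L.length < k) :
    (#(words (2 * k) fun W => Border L W ∧ P W) : ℤ) -
        q * #(words (2 * k - 1) fun W => Border L W ∧ P W) =
      goodCount L P (2 * k) + goodCount L P k +
      goodCount L (fun W => P W ∧ Border (L ++ L) W) (k + L.length) -
      q * (goodCount L P (2 * k - 1) + goodCount L P (k + L.length / 2)) := by
  obtain ⟨k, rfl⟩ : ∃ k', k = k' + 1 := ⟨k - 1, by omega⟩
  obtain ⟨j, hj⟩ := id hodd
  rw [card_even hL hodd hP hk, show 2 * (k + 1) - 1 = 2 * k + 1 by omega,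
    card_odd hL hodd hP (by omega), goodSum_succ,
    show k + 1 + L.length / 2 = k + (L.length + 1) / 2 by omega]
  push_cast
  ring

theorem card_odd_sub (hL : BifixFree L) (hodd : Odd L.length)
    (hP : ∀ V W, Border V W → 2 * L.length < V.length → (P V ↔ P W)) {k : ℕ}
    (hk : L.length < k) :
    (#(words (2 * k + 1) fun W => Border L W ∧ P W) : ℤ) -
        q * #(words (2 * k) fun W => Border L W ∧ P W) =
      goodCount L P (2 * k + 1) + goodCount L P (k + (L.length + 1) / 2) -
      q * (goodCount L P (2 * k) +
        goodCount L (fun W => P W ∧ Border (L ++ L) W) (k + L.length)) := by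
  rw [card_even hL hodd hP hk, card_odd hL hodd hP hk.le]
  push_cast
  ring

theorem border_append_self_congr {V W : List (Fin q)} (h : Border V W)
    (hl : 2 * L.length < V.length) : Border (L ++ L) V ↔ Border (L ++ L) W :=
  ⟨fun hV => hV.trans h, fun hW => hW.of_length_le h (by simp only [List.length_append]; omega)⟩

theorem border_of_border_append_self {W : List (Fin q)} (h : Border (L ++ L) W) : Border L W :=
  Border.trans ⟨List.prefix_append _ _, List.suffix_append _ _⟩ h

/-- The number of words of length `n` that begin and end with `LL`. -/
theorem card_border_append_self (hL : BifixFree L) (hn : 2 * L.length < n) :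
    #(words n fun W => Border L W ∧ Border (L ++ L) W) =
      if 4 * L.length ≤ n then q ^ (n - 4 * L.length) else if n = 3 * L.length then 1 else 0 := by
  rw [card_words_congr fun W _ => and_iff_right_of_imp border_of_border_append_self]
  split_ifs with h4 h3
  · have := card_words_prefix_suffix (n := n) (L ++ L) (L ++ L)
      (by simp only [List.length_append]; omega)
    rw [show n - 4 * L.length = n - ((L ++ L).length + (L ++ L).length) by
      simp only [List.length_append]; omega, ← this]
    rfl
  · rw [card_eq_one]
    refine ⟨L ++ L ++ L, ?_⟩
    ext W
    rw [mem_words, mem_singleton]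
    constructor
    · rintro ⟨rfl, hW⟩
      exact eq_append_append_of_border hL hW hn (by omega)
    · rintro rfl
      refine ⟨by simp only [List.length_append]; omega, List.prefix_append _ _, ?_⟩
      rw [List.append_assoc]
      exact List.suffix_append _ _
  · rw [card_eq_zero, eq_empty_iff_forall_notMem]
    intro W hW
    obtain ⟨rfl, hb⟩ := mem_words.1 hW
    have := congrArg List.length (eq_append_append_of_border hL hb hn (by omega))
    simp only [List.length_append] at this
    omega

theorem card_border_append_self_sub (hL : BifixFree L) (hℓ : 1 < L.length)
    (hn : 2 * L.length + 1 < n) :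
    (#(words n fun W => Border L W ∧ Border (L ++ L) W) : ℤ) -
        q * #(words (n - 1) fun W => Border L W ∧ Border (L ++ L) W) =
      if n = 3 * L.length ∨ n = 4 * L.length then (1 : ℤ)
      else if n = 3 * L.length + 1 then -q else 0 := by
  rw [card_border_append_self hL (by omega), card_border_append_self hL (by omega)]
  by_cases h4 : 4 * L.length < n
  · rw [if_pos h4.le, if_pos (by omega), if_neg (by omega), if_neg (by omega),
      show n - 4 * L.length = n - 1 - 4 * L.length + 1 by omega]
    push_cast
    ring
  · by_cases h4' : n = 4 * L.length
    · subst h4'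
      rw [if_pos le_rfl, if_neg (by omega), if_neg (by omega), if_pos (Or.inr rfl)]
      simp
    · split_ifs <;> first | (exfalso; omega) | simp

theorem card_not_border_append_self_sub (hL : BifixFree L) (hℓ : 1 < L.length)
    (hn : 2 * L.length + 1 < n) :
    (#(words n fun W => Border L W ∧ ¬ Border (L ++ L) W) : ℤ) -
        q * #(words (n - 1) fun W => Border L W ∧ ¬ Border (L ++ L) W) =
      - (if n = 3 * L.length ∨ n = 4 * L.length then (1 : ℤ)
      else if n = 3 * L.length + 1 then -q else 0) := by
  have h1 := card_words_add (n := n) (Border L) (Border (L ++ L))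
  have h2 := card_words_add (n := n - 1) (Border L) (Border (L ++ L))
  have h3 : #(words n (Border L)) = _ := card_words_prefix_suffix L L (by omega)
  have h4 : #(words (n - 1) (Border L)) = _ := card_words_prefix_suffix L L (by omega)
  rw [h3, show n - (L.length + L.length) = n - 1 - (L.length + L.length) + 1 by omega,
    pow_succ'] at h1
  rw [h4] at h2
  have h5 := card_border_append_self_sub hL hℓ hn
  zify at h1 h2
  linear_combination h1 - q * h2 - h5

theorem goodCount_append_self_of_le (hL : BifixFree L) (hodd : Odd L.length)
    (hn : n ≤ 4 * L.length) :
    goodCount L (Border (L ++ L)) n = if n = 3 * L.length then 1 else 0 := by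
  have hpos := hodd.pos
  obtain ⟨j, hj⟩ := id hodd
  have h3 : goodCount L (Border (L ++ L)) (3 * L.length) = 1 := by
    have h := card_odd hL hodd (fun V W => border_append_self_congr) (k := 3 * j + 1) (by omega)
    rw [card_border_append_self hL (by omega), if_neg (by omega), if_pos (by omega),
      goodSum_of_le (by omega), goodCount_of_le (n := 3 * j + 1 + _) _ (by omega),
      show 2 * (3 * j + 1) + 1 = 3 * L.length by omega] at h
    simpa using h.symm
  split_ifs with hn3
  · rw [hn3, h3]
  by_cases hn2 : n ≤ 2 * L.length
  · exact goodCount_of_le _ hn2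
  by_cases hn4 : n = 4 * L.length
  · have h := card_even hL hodd (fun V W => border_append_self_congr) (k := 2 * L.length)
      (by omega)
    rw [card_border_append_self hL (by omega), if_pos (by omega), goodSum_of_le le_rfl] at h
    simp only [and_self] at h
    rw [show 2 * L.length + L.length = 3 * L.length by ring, h3,
      show 2 * (2 * L.length) = n by omega] at h
    rw [hn4] at h ⊢
    simpa using h
  · have h := card_border_append_self (q := q) (n := n) hL (by omega)
    rw [if_neg (by omega), if_neg hn3, card_eq_zero] at h
    rw [goodCount, if_pos (by omega), card_eq_zero, eq_empty_iff_forall_notMem]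
    intro W hW
    obtain ⟨hW, hG, hP⟩ := mem_words.1 hW
    exact eq_empty_iff_forall_notMem.1 h W (mem_words.2 ⟨hW, hG.1, hP⟩)

theorem mem_LAL_iff {W : List (Fin q)} :
    (∃ A, A ≠ [] ∧ W = L ++ A ++ L) ↔ Border L W ∧ 2 * L.length < W.length := by
  rw [prefix_append_suffix_iff, Border, and_assoc, two_mul]

theorem mem_LLALL_iff {W : List (Fin q)} :
    (∃ A, A ≠ [] ∧ W = L ++ L ++ A ++ L ++ L) ↔
      Border (L ++ L) W ∧ 4 * L.length < W.length := by
  simp only [List.append_assoc _ L L]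
  rw [prefix_append_suffix_iff, Border, and_assoc, List.length_append,
    show L.length + L.length + (L.length + L.length) = 4 * L.length by ring]

theorem dCount_eq_goodCount (hL : BifixFree L) (hpos : 0 < L.length) :
    dCount q L n = if n ≤ 4 * L.length then 0 else goodCount L (Border (L ++ L)) n := by
  have h : dCount q L n = #(words n fun W => (Border L W ∧ 2 * L.length < W.length) ∧
      (Border (L ++ L) W ∧ 4 * L.length < W.length) ∧ Z2BifixFree W) :=
    Nat.subtype_card _ fun W => by rw [mem_words, mem_LAL_iff, mem_LLALL_iff]
  rw [h]
  split_ifs with hn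
  · rw [card_eq_zero, eq_empty_iff_forall_notMem]
    intro W hW
    have := mem_words.1 hW
    omega
  · rw [goodCount, if_pos (by omega)]
    refine card_words_congr fun W hW => ?_
    constructor
    · rintro ⟨⟨h1, -⟩, ⟨h2, -⟩, h3⟩
      exact ⟨⟨h1, (h1.z2BifixFree_iff hL hpos).1 h3⟩, h2⟩
    · rintro ⟨⟨h1, h3⟩, h2⟩
      exact ⟨⟨h1, by omega⟩, ⟨h2, by omega⟩, (h1.z2BifixFree_iff hL hpos).2 h3⟩

theorem cCount_eq_goodCount (hL : BifixFree L) (hodd : Odd L.length) :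
    cCount q L n = goodCount L (fun W => ¬ Border (L ++ L) W) n +
      if n = 3 * L.length then 1 else 0 := by
  have hpos := hodd.pos
  have h : cCount q L n = #(words n fun W => (Border L W ∧ 2 * L.length < W.length) ∧
      ¬ (Border (L ++ L) W ∧ 4 * L.length < W.length) ∧ Z2BifixFree W) :=
    Nat.subtype_card _ fun W => by rw [mem_words, mem_LAL_iff, mem_LLALL_iff]
  rw [h]
  by_cases hn : n ≤ 2 * L.length
  · rw [goodCount_of_le _ hn, if_neg (by omega), card_eq_zero, eq_empty_iff_forall_notMem]
    intro W hW
    have := mem_words.1 hW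
    omega
  have hgood : ∀ W : List (Fin q), W.length = n →
      (((Border L W ∧ 2 * L.length < W.length) ∧
        ¬ (Border (L ++ L) W ∧ 4 * L.length < W.length) ∧ Z2BifixFree W) ↔
      Good L W ∧ ¬ (Border (L ++ L) W ∧ 4 * L.length < n)) := by
    rintro W rfl
    constructor
    · rintro ⟨⟨h1, -⟩, h2, h3⟩
      exact ⟨⟨h1, (h1.z2BifixFree_iff hL hpos).1 h3⟩, h2⟩
    · rintro ⟨⟨h1, h3⟩, h2⟩
      exact ⟨⟨h1, by omega⟩, h2, (h1.z2BifixFree_iff hL hpos).2 h3⟩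
  rw [card_words_congr hgood]
  by_cases hn4 : n ≤ 4 * L.length
  · rw [← goodCount_append_self_of_le hL hodd hn4, goodCount, goodCount, if_pos (by omega),
      if_pos (by omega), add_comm, card_words_add]
    exact card_words_congr fun W _ => and_iff_left fun h => by omega
  · rw [if_neg (by omega), goodCount, if_pos (by omega), add_zero]
    exact card_words_congr fun W _ => by simp [show 4 * L.length < n by omega]

theorem goodCount_false (n : ℕ) :
    goodCount L (fun W => ¬ Border (L ++ L) W ∧ Border (L ++ L) W) n = 0 := by
  rw [goodCount]
  split_ifs
  · rw [card_eq_zero, eq_empty_iff_forall_notMem]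
    intro W hW
    have := mem_words.1 hW
    tauto
  · rfl

end Counting

end BifixCount

open BifixCount

/-- The recursion for `cCount` and `dCount` when `|L| = ℓ` is odd, `ℓ > 1`.
Here `⌊x/2⌋` is natural division and `⌈x/2⌉ = (x+1)/2`. -/
theorem cd_recursion_odd (q ℓ : ℕ) (hq : 1 ≤ q) (L : List (Fin q))
    (hlen : L.length = ℓ) (hbf : BifixFree L) (hodd : Odd ℓ) (hℓ : 1 < ℓ) :
    (∀ n, 1 ≤ n → n ≤ 2 * ℓ → cCount q L n = 0) ∧
    cCount q L (2 * ℓ + 1) = q ∧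
    (cCount q L (4 * ℓ) : ℤ) =
      q * (cCount q L (4 * ℓ - 1) + cCount q L (5 * ℓ / 2)) - (cCount q L (2 * ℓ) + 1) ∧
    (cCount q L (5 * ℓ) : ℤ) =
      q * cCount q L (5 * ℓ - 1) - (cCount q L (3 * ℓ) - 1) ∧
    (cCount q L (5 * ℓ + 1) : ℤ) =
      q * (cCount q L (5 * ℓ) + cCount q L (3 * ℓ) - 1) - cCount q L ((5 * ℓ + 1) / 2) ∧
    (cCount q L (6 * ℓ) : ℤ) =
      q * (cCount q L (6 * ℓ - 1) + cCount q L (7 * ℓ / 2)) - (cCount q L (3 * ℓ) - 1) ∧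
    (∀ k, ℓ < k → k ≠ 2 * ℓ → k ≠ (5 * ℓ + 1) / 2 → k ≠ 3 * ℓ →
      (cCount q L (2 * k) : ℤ) =
        q * (cCount q L (2 * k - 1) + cCount q L (k + ℓ / 2)) - cCount q L k) ∧
    (∀ k, ℓ < k → k ≠ 5 * ℓ / 2 →
      (cCount q L (2 * k + 1) : ℤ) =
        q * cCount q L (2 * k) - cCount q L (k + (ℓ + 1) / 2)) ∧
    (∀ n, 1 ≤ n → n ≤ 4 * ℓ → dCount q L n = 0) ∧
    dCount q L (4 * ℓ + 1) = q ∧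
    (dCount q L (5 * ℓ) : ℤ) = q * dCount q L (5 * ℓ - 1) - 1 ∧
    (dCount q L (5 * ℓ + 1) : ℤ) = q * (dCount q L (5 * ℓ) + 1) ∧
    (dCount q L (6 * ℓ) : ℤ) = q * dCount q L (6 * ℓ - 1) - 1 ∧
    (∀ k, 2 * ℓ < k → k ≠ (5 * ℓ + 1) / 2 → k ≠ 3 * ℓ →
      (dCount q L (2 * k) : ℤ) =
        q * (dCount q L (2 * k - 1) + dCount q L (k + ℓ / 2)) -
          (dCount q L k + dCount q L (k + ℓ))) ∧
    (∀ k, 2 * ℓ < k → k ≠ 5 * ℓ / 2 →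
      (dCount q L (2 * k + 1) : ℤ) =
        q * (dCount q L (2 * k) + dCount q L (k + ℓ)) - dCount q L (k + (ℓ + 1) / 2)) := by
  subst hlen
  obtain ⟨j, hj⟩ := id hodd
  set e := goodCount L (Border (L ++ L)) with he
  set f := goodCount L (fun W => ¬ Border (L ++ L) W) with hf
  have hnot : ∀ V W, Border V W → 2 * L.length < V.length →
      (¬ Border (L ++ L) V ↔ ¬ Border (L ++ L) W) :=
    fun V W hb hl => not_congr (border_append_self_congr hb hl)
  have e_even : ∀ k, L.length < k → ((if 2 * k = 3 * L.length ∨ 2 * k = 4 * L.length then (1 : ℤ)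
      else if 2 * k = 3 * L.length + 1 then -q else 0) =
      e (2 * k) + e k + e (k + L.length) - q * (e (2 * k - 1) + e (k + L.length / 2))) := by
    intro k hk
    rw [← card_border_append_self_sub hbf hℓ (by omega),
      card_even_sub hbf hodd (fun V W => border_append_self_congr) hk]
    simp only [and_self, he]
  have e_odd : ∀ k, L.length < k →
      ((if 2 * k + 1 = 3 * L.length ∨ 2 * k + 1 = 4 * L.length then (1 : ℤ)
      else if 2 * k + 1 = 3 * L.length + 1 then -q else 0) =
      e (2 * k + 1) + e (k + (L.length + 1) / 2) - q * (e (2 * k) + e (k + L.length))) := by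
    intro k hk
    rw [← card_border_append_self_sub hbf hℓ (by omega), Nat.add_sub_cancel,
      card_odd_sub hbf hodd (fun V W => border_append_self_congr) hk]
    simp only [and_self, he]
  have f_even : ∀ k, L.length < k →
      (-(if 2 * k = 3 * L.length ∨ 2 * k = 4 * L.length then (1 : ℤ)
      else if 2 * k = 3 * L.length + 1 then -q else 0) =
      f (2 * k) + f k - q * (f (2 * k - 1) + f (k + L.length / 2))) := by
    intro k hk
    rw [← card_not_border_append_self_sub hbf hℓ (by omega), card_even_sub hbf hodd hnot hk,
      goodCount_false, Nat.cast_zero, add_zero]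
  have f_odd : ∀ k, L.length < k →
      (-(if 2 * k + 1 = 3 * L.length ∨ 2 * k + 1 = 4 * L.length then (1 : ℤ)
      else if 2 * k + 1 = 3 * L.length + 1 then -q else 0) =
      f (2 * k + 1) + f (k + (L.length + 1) / 2) - q * f (2 * k)) := by
    intro k hk
    rw [← card_not_border_append_self_sub hbf hℓ (by omega), Nat.add_sub_cancel,
      card_odd_sub hbf hodd hnot hk, goodCount_false, Nat.cast_zero, add_zero]
  have hc : ∀ n, n ≠ 3 * L.length → cCount q L n = f n := by
    intro n hn
    rw [cCount_eq_goodCount hbf hodd, if_neg hn, add_zero]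
  have hc3 : cCount q L (3 * L.length) = f (3 * L.length) + 1 := by
    rw [cCount_eq_goodCount hbf hodd, if_pos rfl]
  have hd0 : ∀ n, n ≤ 4 * L.length → dCount q L n = 0 := by
    intro n hn
    rw [dCount_eq_goodCount hbf hodd.pos, if_pos hn]
  have hd : ∀ n, n ≠ 3 * L.length → dCount q L n = e n := by
    intro n hn
    rw [dCount_eq_goodCount hbf hodd.pos]
    split_ifs with h4
    · rw [he, goodCount_append_self_of_le hbf hodd h4, if_neg hn]
    · rfl
  have he3 : e (3 * L.length) = 1 := by
    rw [he, goodCount_append_self_of_le hbf hodd (by omega), if_pos rfl]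
  have he0 : ∀ n, n ≤ 4 * L.length → n ≠ 3 * L.length → e n = 0 := by
    intro n hn hn3
    rw [he, goodCount_append_self_of_le hbf hodd hn, if_neg hn3]
  have hf0 : ∀ n, n ≤ 2 * L.length → f n = 0 := fun n hn => goodCount_of_le _ hn
  refine ⟨?_, ?_, ?_, ?_, ?_, ?_, ?_, ?_, ?_, ?_, ?_, ?_, ?_, ?_, ?_⟩
  · intro n _ hn
    rw [hc n (by omega), hf0 n hn]
  · have h := card_odd hbf hodd hnot le_rfl
    have h1 := card_words_add (n := 2 * L.length + 1) (Border L) (Border (L ++ L))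
    have h2 := card_words_prefix_suffix (n := 2 * L.length + 1) L L (by omega)
    rw [card_border_append_self hbf (by omega), if_neg (by omega), if_neg (by omega), zero_add]
      at h1
    rw [hc _ (by omega), hf]
    rw [goodSum_of_le (by omega), goodCount_of_le (n := L.length + (L.length + 1) / 2) _
      (by omega), mul_zero, zero_add, add_zero, h1] at h
    rw [← h]
    refine h2.trans ?_
    rw [show 2 * L.length + 1 - (L.length + L.length) = 1 by omega, pow_one]
  · have h := f_even (2 * L.length) (by omega)
    rw [if_pos (by omega), show 2 * (2 * L.length) = 4 * L.length by ring,
      show 2 * L.length + L.length / 2 = 5 * L.length / 2 by omega] at h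
    rw [hc _ (by omega), hc _ (by omega), hc _ (by omega), hc _ (by omega)]
    linear_combination -h
  · have h := f_odd (5 * j + 2) (by omega)
    rw [if_neg (by omega), if_neg (by omega), show 2 * (5 * j + 2) = 5 * L.length - 1 by omega,
      show 5 * L.length - 1 + 1 = 5 * L.length by omega,
      show 5 * j + 2 + (L.length + 1) / 2 = 3 * L.length by omega] at h
    rw [hc _ (by omega), hc _ (by omega), hc3]
    push_cast
    linear_combination -h
  · have h := f_even (5 * j + 3) (by omega)
    rw [if_neg (by omega), if_neg (by omega),
      show 2 * (5 * j + 3) - 1 = 5 * L.length by omega,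
      show 2 * (5 * j + 3) = 5 * L.length + 1 by omega,
      show 5 * j + 3 + L.length / 2 = 3 * L.length by omega] at h
    rw [hc _ (by omega), hc (5 * L.length) (by omega), hc3, hc _ (by omega),
      show (5 * L.length + 1) / 2 = 5 * j + 3 by omega]
    push_cast
    linear_combination -h
  · have h := f_even (3 * L.length) (by omega)
    rw [if_neg (by omega), if_neg (by omega), show 2 * (3 * L.length) = 6 * L.length by ring,
      show 3 * L.length + L.length / 2 = 7 * L.length / 2 by omega] at h
    rw [hc _ (by omega), hc _ (by omega), hc (7 * L.length / 2) (by omega), hc3]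
    push_cast
    linear_combination -h
  · intro k hk h2 h5 h3
    have h := f_even k hk
    rw [if_neg (by omega)] at h
    rw [hc (2 * k) (by omega), hc (k + L.length / 2) (by omega), hc k (by omega)]
    split_ifs at h with hk3
    · rw [show 2 * k - 1 = 3 * L.length by omega] at h ⊢
      rw [hc3]
      push_cast
      linear_combination -h
    · rw [hc (2 * k - 1) (by omega)]
      linear_combination -h
  · intro k hk h5
    have h := f_odd k hk
    rw [hc (2 * k) (by omega), hc (k + (L.length + 1) / 2) (by omega)]
    by_cases hk3 : 2 * k + 1 = 3 * L.length
    · rw [if_pos (Or.inl hk3)] at h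
      rw [hk3] at h ⊢
      rw [hc3]
      push_cast
      linear_combination -h
    · rw [if_neg (by omega), if_neg (by omega)] at h
      rw [hc (2 * k + 1) hk3]
      linear_combination -h
  · exact fun n _ hn => hd0 n hn
  · have h := e_odd (2 * L.length) (by omega)
    rw [if_neg (by omega), if_neg (by omega), he0 (2 * L.length + _) (by omega) (by omega),
      he0 (2 * (2 * L.length)) (by omega) (by omega),
      show 2 * L.length + L.length = 3 * L.length by ring, he3,
      show 2 * (2 * L.length) + 1 = 4 * L.length + 1 by ring] at h
    rw [hd _ (by omega)]
    push_cast at h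
    zify
    linear_combination -h
  · have h := e_odd (5 * j + 2) (by omega)
    rw [if_neg (by omega), if_neg (by omega), show 2 * (5 * j + 2) = 5 * L.length - 1 by omega,
      show 5 * L.length - 1 + 1 = 5 * L.length by omega,
      show 5 * j + 2 + (L.length + 1) / 2 = 3 * L.length by omega, he3,
      he0 (5 * j + 2 + L.length) (by omega) (by omega)] at h
    rw [hd _ (by omega), hd _ (by omega)]
    push_cast at h
    linear_combination -h
  · have h := e_even (5 * j + 3) (by omega)
    rw [if_neg (by omega), if_neg (by omega),
      show 2 * (5 * j + 3) - 1 = 5 * L.length by omega,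
      show 2 * (5 * j + 3) = 5 * L.length + 1 by omega,
      show 5 * j + 3 + L.length / 2 = 3 * L.length by omega, he3,
      he0 (5 * j + 3) (by omega) (by omega), he0 (5 * j + 3 + _) (by omega) (by omega)] at h
    rw [hd _ (by omega), hd _ (by omega)]
    push_cast at h
    linear_combination -h
  · have h := e_even (3 * L.length) (by omega)
    rw [if_neg (by omega), if_neg (by omega), show 2 * (3 * L.length) = 6 * L.length by ring,
      he3, he0 (3 * L.length + L.length) (by omega) (by omega),
      he0 (3 * L.length + L.length / 2) (by omega) (by omega)] at h
    rw [hd _ (by omega), hd _ (by omega)]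
    push_cast at h
    linear_combination -h
  · intro k hk h5 h3
    have h := e_even k (by omega)
    rw [if_neg (by omega), if_neg (by omega)] at h
    rw [hd (2 * k) (by omega), hd (2 * k - 1) (by omega), hd (k + L.length / 2) (by omega),
      hd k (by omega), hd (k + L.length) (by omega)]
    linear_combination -h
  · intro k hk h5
    have h := e_odd k (by omega)
    rw [if_neg (by omega), if_neg (by omega)] at h
    rw [hd (2 * k) (by omega), hd (2 * k + 1) (by omega), hd (k + (L.length + 1) / 2) (by omega),
      hd (k + L.length) (by omega)]
    linear_combination -h
end
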